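/- arXiv:2406.16475 — 2 statements merged into one kernel-verified Lean document; each statement's English description precedes it below -/
import Mathlib

section
/- There exists a universal constant C such that for every nonempty string w, there exists a valid bidirectional macro scheme for w whose size (number of phrases) is at most C · r_B(w). -/
open List

variable {α : Type*} [LinearOrder α]

/-- A Lyndon word: nonempty and lexicographically strictly smaller than all of
its proper nonempty suffixes. -/
def IsLyndon (w : List α) : Prop :=
  w ≠ [] ∧ ∀ i, 0 < i → i < w.length → w < w.drop i

/-- `fs` is the Lyndon factorization of `w` (factors listed with multiplicity,
so a necklace `f_i^{k_i}` contributes `k_i` copies of `f_i`): the factors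
concatenate to `w`, each factor is Lyndon, and the sequence of factors is
lexicographically non-increasing. -/
def IsLyndonFactorization (w : List α) (fs : List (List α)) : Prop :=
  fs.flatten = w ∧ (∀ f ∈ fs, IsLyndon f) ∧ fs.Chain' (fun a b => b ≤ a)

/-- All cyclic rotations of `w` (with multiplicity). -/
def rotations (w : List α) : List (List α) :=
  (List.range w.length).map fun i => w.drop i ++ w.take i

/-- The rotation moving the last character of `w` to the front. -/
def rotR (w : List α) : List α :=
  w.drop (w.length - 1) ++ w.take (w.length - 1)

/-- Number of maximal runs of equal consecutive characters of `s`. -/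
def runCount (s : List α) : ℕ := (s.destutter (· ≠ ·)).length

/-- The Burrows–Wheeler transform: concatenation of the last characters of all
`|w|` cyclic rotations of `w`, listed in lexicographic order. -/
def BWT (w : List α) : List α :=
  (List.insertionSort (· ≤ ·) (rotations w)).flatMap fun r => r.getLast?.toList

/-- The ω-order comparison: `x ≼_ω y` iff `x^∞ ≤ y^∞`, equivalently `xy ≤ yx`. -/
def omegaLE (x y : List α) : Prop := x ++ y ≤ y ++ x

instance : DecidableRel (omegaLE (α := α)) := fun x y =>
  inferInstanceAs (Decidable (x ++ y ≤ y ++ x))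

/-- The bijective Burrows–Wheeler transform, expressed in terms of the Lyndon
factorization `fs` of a word: concatenation of the last characters of all
cyclic rotations of all Lyndon factors (with multiplicity), listed in ω-order. -/
def BBWTof (fs : List (List α)) : List α :=
  (List.insertionSort omegaLE (fs.flatMap rotations)).flatMap fun r => r.getLast?.toList

/-- A phrase of a bidirectional macro scheme: either an explicit single
character, or a phrase of length `len` copied from the source position `src`
(0-indexed) of the text. -/
inductive Phrase (α : Type*) where
  | lit (c : α) : Phrase α
  | copy (src len : ℕ) : Phrase α

/-- The length of a phrase. -/
def phraseLen {α : Type*} : Phrase α → ℕ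
  | .lit _ => 1
  | .copy _ len => len

/-- The source position assigned to text position `q` by a list of phrases:
`none` for positions of explicit (length-1) phrases, and the corresponding
position of the source occurrence for positions of copy phrases. -/
def posSource {α : Type*} : List (Phrase α) → ℕ → Option ℕ
  | [], _ => none
  | .lit _ :: ps, q => if q = 0 then none else posSource ps (q - 1)
  | .copy s L :: ps, q => if q < L then some (s + q) else posSource ps (q - L)

/-- Local correctness of the phrase starting at text position `start` of `w`:
an explicit phrase stores the character of the text, and a copy phrase has
length at least 2 and copies an occurrence of the same substring of `w`. -/
def PhraseOK {α : Type*} (w : List α) (start : ℕ) : Phrase α → Prop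
  | .lit c => w[start]? = some c
  | .copy s L => 2 ≤ L ∧ s + L ≤ w.length ∧ ∀ j < L, w[start + j]? = w[s + j]?

/-- `ps` is a valid bidirectional macro scheme for `w`: the phrases partition
the positions of `w` into consecutive blocks, each phrase is correct, and the
map sending each position of a copy phrase to its source position induces no
cycles (witnessed by a rank function), so `w` is uniquely recoverable. -/
def IsBMS (w : List α) (ps : List (Phrase α)) : Prop :=
  (ps.map phraseLen).sum = w.length ∧
  (∀ k (hk : k < ps.length), PhraseOK w ((ps.take k).map phraseLen).sum ps[k]) ∧
  ∃ ρ : ℕ → ℕ, ∀ q q', posSource ps q = some q' → ρ q' < ρ q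

namespace BB

theorem bms_build {β : Type} (w : List β) (src : ℕ → Option ℕ)
    (hsrc : ∀ q s, src q = some s → s < w.length ∧ w[q]? = w[s]?)
    (B : Finset ℕ)
    (hB : ∀ q, q < w.length → q ∉ B → ∃ q0 s, q = q0 + 1 ∧ src q0 = some s ∧ src q = some (s + 1)) :
    ∀ d a, a + d = w.length → (a < w.length → a ∈ B) →
      ∃ ps : List (Phrase β), (ps.map phraseLen).sum = d ∧
        (∀ k (hk : k < ps.length), PhraseOK w (a + ((ps.take k).map phraseLen).sum) ps[k]) ∧
        (∀ q q', posSource ps q = some q' → src (a + q) = some q') ∧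
        ps.length ≤ (B.filter (fun x => a ≤ x)).card := by
  intro d
  induction d using Nat.strong_induction_on with
  | _ d ih =>
    intro a had haB
    rcases Nat.eq_zero_or_pos d with hd | hd
    · subst hd
      exact ⟨[], by simp, by simp, by simp [posSource], by simp⟩
    · have haB' := haB (by omega)
      have hex : ∃ L, 1 ≤ L ∧ (a + L = w.length ∨ a + L ∈ B) := ⟨d, hd, Or.inl had⟩
      classical
      obtain ⟨L, ⟨hL1, hL2⟩, hmin⟩ : ∃ L, (1 ≤ L ∧ (a + L = w.length ∨ a + L ∈ B)) ∧
          ∀ i, i < L → ¬ (1 ≤ i ∧ (a + i = w.length ∨ a + i ∈ B)) :=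
        ⟨Nat.find hex, Nat.find_spec hex, fun i hi => Nat.find_min hex hi⟩
      have hLd : L ≤ d := by
        by_contra h
        exact hmin d (by omega) ⟨hd, Or.inl had⟩
      obtain ⟨ps, h1, h2, h3, h4⟩ := ih (d - L) (by omega) (a + L) (by omega) (by
        intro h; rcases hL2 with h' | h'
        · omega
        · exact h')
      have hcard : (B.filter (fun x => a + L ≤ x)).card + 1 ≤ (B.filter (fun x => a ≤ x)).card := by
        rw [← Finset.card_insert_of_notMem (a := a) (by simp; omega)]
        apply Finset.card_le_card
        intro x hx
        simp only [Finset.mem_insert, Finset.mem_filter] at hx ⊢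
        rcases hx with rfl | hx
        · exact ⟨haB', le_rfl⟩
        · exact ⟨hx.1, by omega⟩
      have hni : ∀ i, 1 ≤ i → i < L → a + i ∉ B ∧ a + i < w.length := by
        intro i hi hiL
        have := hmin i hiL
        exact ⟨fun h => this ⟨hi, Or.inr h⟩, by omega⟩
      have key : ∀ ph : Phrase β, phraseLen ph = L → PhraseOK w a ph →
          (∀ q q', posSource (ph :: ps) q = some q' → src (a + q) = some q') → 
          ∃ ps : List (Phrase β), (ps.map phraseLen).sum = d ∧
        (∀ k (hk : k < ps.length), PhraseOK w (a + ((ps.take k).map phraseLen).sum) ps[k]) ∧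
        (∀ q q', posSource ps q = some q' → src (a + q) = some q') ∧
        ps.length ≤ (B.filter (fun x => a ≤ x)).card := by
        intro ph hl hok hs
        refine ⟨ph :: ps, ?_, ?_, hs, ?_⟩
        · simp [hl, h1]; omega
        · intro k hk
          cases k with
          | zero => simpa using hok
          | succ k =>
            have := h2 k (by simpa using hk)
            simpa [hl, Nat.add_assoc] using this
        · simp; omega
      rcases Nat.lt_or_ge L 2 with hL | hL
      · have hL' : L = 1 := by omega
        subst hL'
        apply key (.lit (w[a]'(by omega))) rfl
        · simp [PhraseOK]
        · intro q q' hq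
          simp only [posSource] at hq
          split_ifs at hq with h0
          have := h3 _ _ hq
          rwa [show a + 1 + (q - 1) = a + q by omega] at this
      · obtain ⟨s, hs⟩ : ∃ s, src a = some s := by
          obtain ⟨q0, s, h, h', _⟩ := hB (a + 1) (hni 1 le_rfl (by omega)).2 (hni 1 le_rfl (by omega)).1
          exact ⟨s, by rw [show a = q0 by omega]; exact h'⟩
        have hall : ∀ i, i < L → src (a + i) = some (s + i) := by
          intro i
          induction i with
          | zero => intro _; simpa using hs
          | succ i ihi =>
            intro hi
            obtain ⟨q0, s', h, h', h''⟩ := hB (a + (i + 1)) (hni _ (by omega) hi).2 (hni _ (by omega) hi).1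
            have e : q0 = a + i := by omega
            rw [e, ihi (by omega)] at h'
            rw [h'']
            simp at h' ⊢
            omega
        apply key (.copy s L) rfl
        · refine ⟨hL, ?_, ?_⟩
          · have := (hsrc _ _ (hall (L - 1) (by omega))).1
            omega
          · intro j hj
            exact (hsrc _ _ (hall j hj)).2
        · intro q q' hq
          simp only [posSource] at hq
          split_ifs at hq with h0
          · rw [hall q h0]; exact hq
          · have := h3 _ _ hq
            rwa [show a + L + (q - L) = a + q by omega] at this

theorem run_aux {β : Type} [LinearOrder β] : ∀ (l : List β) (a : β),
    ((Finset.range l.length).filter (fun k => (a :: l)[k]? ≠ (a :: l)[k + 1]?)).card + 1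
      ≤ (List.destutter' (· ≠ ·) a l).length := by
  intro l
  induction l with
  | nil => intro a; simp
  | cons b l ih =>
    intro a
    have h := ih b
    rw [Finset.card_filter] at h ⊢
    rw [List.length_cons, Finset.sum_range_succ']
    rw [List.destutter'_cons]
    by_cases hab : a = b
    · subst hab
      simpa using h
    · simp [hab] at h ⊢
      omega

theorem lex_lt_iff {β : Type} [LinearOrder β] (X Y : ℕ → β) :
    toLex X < toLex Y ↔ ∃ i, (∀ j < i, X j = Y j) ∧ X i < Y i := Iff.rfl

theorem lex_head {β : Type} [LinearOrder β] {X Y : ℕ → β} (h : toLex X ≤ toLex Y) : X 0 ≤ Y 0 := by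
  rcases h.lt_or_eq with h | h
  · obtain ⟨i, hi, hlt⟩ := (lex_lt_iff X Y).1 h
    rcases Nat.eq_zero_or_pos i with rfl | hp
    · exact hlt.le
    · exact (hi 0 hp).le
  · exact (congrFun (toLex.injective h) 0).le

theorem lex_shift {β : Type} [LinearOrder β] {X Y : ℕ → β} (h : X 0 = Y 0) :
    toLex X < toLex Y ↔ toLex (fun t => X (t + 1)) < toLex (fun t => Y (t + 1)) := by
  rw [lex_lt_iff, lex_lt_iff]
  constructor
  · rintro ⟨i, hi, hlt⟩
    cases i with
    | zero => exact absurd h hlt.ne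
    | succ i => exact ⟨i, fun j hj => hi _ (by omega), hlt⟩
  · rintro ⟨i, hi, hlt⟩
    refine ⟨i + 1, fun j hj => ?_, hlt⟩
    cases j with
    | zero => exact h
    | succ j => exact hi j (by omega)

/-- A periodic word smaller than all of its nontrivial shifts. -/
structure LyInf {β : Type} [LinearOrder β] (F : ℕ → β) (L : ℕ) : Prop where
  pos : 0 < L
  per : ∀ t, F (t + L) = F t
  ly : ∀ s, 0 < s → s < L → toLex F < toLex (fun t => F (s + t))

namespace LyInf
variable {β : Type} [LinearOrder β] {F G : ℕ → β} {L M : ℕ}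

theorem per_mul (h : LyInf F L) (k t : ℕ) : F (L * k + t) = F t := by
  induction k with
  | zero => simp
  | succ k ih => rw [← ih, ← h.per (L * k + t)]; congr 1; ring

theorem mod (h : LyInf F L) (t : ℕ) : F (t % L) = F t := by
  conv_rhs => rw [← Nat.div_add_mod t L]
  rw [h.per_mul]

theorem shift_mod (h : LyInf F L) (s t : ℕ) : F (s % L + t) = F (s + t) := by
  conv_rhs => rw [← Nat.div_add_mod s L, Nat.add_assoc]
  rw [h.per_mul]

theorem le_shift (h : LyInf F L) (s : ℕ) : toLex F ≤ toLex (fun t => F (s + t)) := by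
  have e : (fun t => F (s + t)) = fun t => F (s % L + t) := by
    funext t; rw [h.shift_mod]
  rw [e]
  rcases Nat.eq_zero_or_pos (s % L) with h0 | h0
  · simp [h0]
  · exact (h.ly _ h0 (Nat.mod_lt _ h.pos)).le

theorem dvd (h : LyInf F L) (s : ℕ) (hs : ∀ t, F t = F (s + t)) : L ∣ s := by
  rcases Nat.eq_zero_or_pos (s % L) with h0 | h0
  · exact Nat.dvd_of_mod_eq_zero h0
  · have := h.ly _ h0 (Nat.mod_lt _ h.pos)
    have e : F = (fun t => F (s % L + t)) := by
      funext t; rw [h.shift_mod, ← hs]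
    rw [← e] at this
    exact absurd this (lt_irrefl _)

theorem le_of (h : LyInf F L) (h' : LyInf G M) {a b : ℕ} (e : ∀ t, F (a + t) = G (b + t)) :
    toLex F ≤ toLex G := by
  have hb : b ≤ M * b := Nat.le_mul_of_pos_left _ h'.pos
  have : G = fun t => F (a + (M * b - b) + t) := by
    funext t
    rw [Nat.add_assoc, e, ← h'.per_mul b t]
    congr 1; omega
  rw [this]
  exact h.le_shift _

theorem unique (h : LyInf F L) (h' : LyInf G M) {a b : ℕ} (ha : a < L) (hb : b < M)
    (e : ∀ t, F (a + t) = G (b + t)) : F = G ∧ L = M ∧ a = b := by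
  have hFG : F = G := toLex.injective (le_antisymm (h.le_of h' e) (h'.le_of h (fun t => (e t).symm)))
  subst hFG
  have hLM : L = M := by
    apply Nat.dvd_antisymm
    · exact h.dvd _ (fun t => by rw [Nat.add_comm, h'.per])
    · exact h'.dvd _ (fun t => by rw [Nat.add_comm, h.per])
  subst hLM
  refine ⟨rfl, rfl, ?_⟩
  have haL : a ≤ L * a := Nat.le_mul_of_pos_left _ h.pos
  have hd : L ∣ b + (L * a - a) := by
    apply h.dvd
    intro t
    rw [Nat.add_assoc, ← e, ← h.per_mul a t]
    congr 1; omega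
  have hd2 : (L : ℤ) ∣ (b : ℤ) - a := by
    have h3 : (L : ℤ) ∣ ((b + (L * a - a) : ℕ) : ℤ) := by exact_mod_cast hd
    have h4 : ((b + (L * a - a) : ℕ) : ℤ) = ((b : ℤ) - a) + L * a := by
      push_cast [Nat.cast_sub haL]; ring
    rw [h4] at h3
    exact (Int.dvd_add_left (Dvd.intro _ rfl)).1 h3
  have := Int.eq_zero_of_abs_lt_dvd hd2 (by rw [abs_lt]; constructor <;> omega)
  omega

end LyInf

/-- infinite power of a list -/
def inf {β : Type} (a0 : β) (x : List β) (t : ℕ) : β := x.getD (t % x.length) a0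

theorem omegaLE_iff {β : Type} [LinearOrder β] (a0 : β) (x y : List β) (hx : x ≠ []) (hy : y ≠ []) :
    omegaLE x y ↔ toLex (inf a0 x) ≤ toLex (inf a0 y) := by
  have hxl : 0 < x.length := List.length_pos_iff.2 hx
  have hyl : 0 < y.length := List.length_pos_iff.2 hy
  -- one step: agreement
  have step : ∀ (x y : List β), 0 < x.length → 0 < y.length → ∀ i,
      (∀ j < i, inf a0 x j = inf a0 y j) → ∀ j ≤ i, j < x.length + y.length →
      (x ++ y)[j]? = some (inf a0 x j) := by
    intro x y hxl hyl i hi j hj hjl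
    rcases Nat.lt_or_ge j x.length with h | h
    · rw [List.getElem?_append_left h, inf, Nat.mod_eq_of_lt h]
      simp [h]
    · rw [List.getElem?_append_right h]
      have h2 : j - x.length < y.length := by omega
      have h3 : inf a0 x j = inf a0 x (j - x.length) := by
        unfold inf; rw [Nat.mod_eq_sub_mod h]
      rw [h3, hi _ (by omega), inf, Nat.mod_eq_of_lt h2]
      simp [h2]
  have main : ∀ (x y : List β), 0 < x.length → 0 < y.length →
      toLex (inf a0 x) < toLex (inf a0 y) → x ++ y < y ++ x := by
    intro x y hxl hyl h
    obtain ⟨i, hi, hlt⟩ := (lex_lt_iff _ _).1 h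
    have hil : i < x.length + y.length := by
      by_contra hc
      have hall : ∀ j, inf a0 x j = inf a0 y j := by
        intro j
        induction j using Nat.strong_induction_on with
        | _ j ih =>
          rcases Nat.lt_or_ge j (x.length + y.length) with hj | hj
          · exact hi j (by omega)
          · have px : ∀ t, inf a0 x (t + x.length) = inf a0 x t := by intro t; simp [inf]
            have py : ∀ t, inf a0 y (t + y.length) = inf a0 y t := by intro t; simp [inf]
            obtain ⟨t, rfl⟩ : ∃ t, j = t + x.length + y.length := ⟨j - (x.length + y.length), by omega⟩
            rw [py, ← ih (t + x.length) (by omega), px,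
              show t + x.length + y.length = t + y.length + x.length by omega, px,
              ih (t + y.length) (by omega), py, ih t (by omega)]
      exact absurd (hall i) hlt.ne
    rw [List.lt_iff_exists]
    right
    refine ⟨i, by simpa using hil, by simp; omega, ?_, ?_⟩
    · intro j hj
      have e1 := step x y hxl hyl i hi j hj.le (by omega)
      have e2 := step y x hyl hxl i (fun j hj => (hi j hj).symm) j hj.le (by omega)
      rw [hi j hj, ← e2] at e1
      rw [← Option.some_inj, ← List.getElem?_eq_getElem, ← List.getElem?_eq_getElem]
      exact e1
    · have e1 := step x y hxl hyl i hi i le_rfl (by omega)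
      have e2 := step y x hyl hxl i (fun j hj => (hi j hj).symm) i le_rfl (by omega)
      rw [List.getElem?_eq_getElem (by simp; omega), Option.some_inj] at e1 e2
      rw [e1, e2]
      exact hlt
  have meq : toLex (inf a0 x) = toLex (inf a0 y) → x ++ y = y ++ x := by
    intro h
    have h' : inf a0 x = inf a0 y := toLex.injective h
    apply List.ext_getElem?
    intro j
    rcases Nat.lt_or_ge j (x.length + y.length) with hj | hj
    · rw [step x y hxl hyl j (fun j _ => congrFun h' j) j le_rfl hj,
        step y x hyl hxl j (fun j _ => (congrFun h' j).symm) j le_rfl (by omega), h']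
    · rw [List.getElem?_eq_none (by simpa using hj), List.getElem?_eq_none (by simp; omega)]
  unfold omegaLE
  constructor
  · intro h
    by_contra hc
    exact absurd h (not_le.2 (main y x hyl hxl (not_le.1 hc)))
  · intro h
    rcases h.lt_or_eq with h | h
    · exact (main x y hxl hyl h).le
    · exact (meq h).le

/-- The positions of a word with its Lyndon factorization. -/
structure PS (β : Type) [LinearOrder β] where
  m : ℕ
  n : ℕ
  a0 : β
  st : ℕ → ℕ
  f : ℕ → List β
  c : ℕ → β
  J : ℕ → ℕ
  O : ℕ → ℕ
  st_zero : st 0 = 0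
  st_m : st m = n
  st_succ : ∀ j < m, st (j + 1) = st j + (f j).length
  lyn : ∀ j < m, IsLyndon (f j)
  c_eq : ∀ j < m, ∀ o < (f j).length, c (st j + o) = (f j).getD o a0
  hJ : ∀ q < n, J q < m
  hO : ∀ q < n, O q < (f (J q)).length
  hq : ∀ q < n, q = st (J q) + O q
  sorted : ∀ i j, i ≤ j → j < m → f j ≤ f i

namespace PS
variable {β : Type} [LinearOrder β] (S : PS β)

/-- length of the factor number j -/
def len (j : ℕ) : ℕ := (S.f j).length

theorem st_mono {i j : ℕ} (h : i ≤ j) (hj : j ≤ S.m) : S.st i ≤ S.st j := by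
  induction j, h using Nat.le_induction with
  | base => exact le_rfl
  | succ j h ih =>
    rw [S.st_succ j (by omega)]
    have := ih (by omega)
    omega

theorem len_pos {j : ℕ} (hj : j < S.m) : 0 < S.len j := List.length_pos_iff.2 (S.lyn j hj).1

theorem st_step {i j : ℕ} (h : i < j) (hj : j ≤ S.m) : S.st i + S.len i ≤ S.st j := by
  have := S.st_mono (i := i + 1) (j := j) h hj
  rwa [S.st_succ i (by omega)] at this

theorem pos_lt {j o : ℕ} (hj : j < S.m) (ho : o < S.len j) : S.st j + o < S.n := by
  have := S.st_step hj le_rfl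
  rw [S.st_m] at this
  omega

theorem JO_unique {i j o o' : ℕ} (hi : i < S.m) (hj : j < S.m) (ho : o < S.len i) (ho' : o' < S.len j)
    (h : S.st i + o = S.st j + o') : i = j ∧ o = o' := by
  rcases lt_trichotomy i j with hij | rfl | hij
  · have := S.st_step hij hj.le; omega
  · exact ⟨rfl, by omega⟩
  · have := S.st_step hij hi.le; omega

theorem JO {j o : ℕ} (hj : j < S.m) (ho : o < S.len j) :
    S.J (S.st j + o) = j ∧ S.O (S.st j + o) = o := by
  have h := S.pos_lt hj ho
  exact S.JO_unique (S.hJ _ h) hj (S.hO _ h) ho (S.hq _ h).symm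

theorem hO' {q : ℕ} (h : q < S.n) : S.O q < S.len (S.J q) := S.hO q h

/-- infinite power of the factor number j -/
def F (j t : ℕ) : β := S.c (S.st j + t % S.len j)

/-- the infinite word read at position p -/
def W (p t : ℕ) : β := S.F (S.J p) (S.O p + t)

def next (p : ℕ) : ℕ := S.st (S.J p) + (S.O p + 1) % S.len (S.J p)

def prev (p : ℕ) : ℕ := S.st (S.J p) + (S.O p + (S.len (S.J p) - 1)) % S.len (S.J p)

theorem lyInf {j : ℕ} (hj : j < S.m) : LyInf (S.F j) (S.len j) := by
  refine ⟨S.len_pos hj, fun t => by simp [F], fun s h0 hs => ?_⟩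
  have h := (S.lyn j hj).2 s h0 hs
  rw [List.lt_iff_exists] at h
  rcases h with ⟨_, h⟩ | ⟨i, h1, h2, h3, h4⟩
  · simp at h; unfold len at hs; omega
  · have h2' : s + i < S.len j := by simp at h2; unfold len; omega
    have hF : ∀ t, (h : t < (S.f j).length) → S.F j t = (S.f j)[t] := by
      intro t h
      unfold F
      rw [Nat.mod_eq_of_lt (show t < S.len j from h), S.c_eq j hj t h]
      simp [h]
    refine (lex_lt_iff _ _).2 ⟨i, fun k hk => ?_, ?_⟩
    · have := h3 k hk
      rw [hF k (by omega), hF (s + k) (by unfold len at h2'; omega), this]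
      simp
    · rw [hF i h1, hF (s + i) h2']
      rw [List.getElem_drop] at h4
      exact h4

theorem f_ext {i j : ℕ} (hi : i < S.m) (hj : j < S.m) (hl : S.len i = S.len j)
    (h : S.F i = S.F j) : S.f i = S.f j := by
  apply List.ext_getElem hl
  intro o h1 h2
  have e := congrFun h o
  unfold F at e
  rw [Nat.mod_eq_of_lt (show o < S.len i from h1), Nat.mod_eq_of_lt (show o < S.len j from h2), S.c_eq i hi o h1, S.c_eq j hj o h2] at e
  simpa [h1, h2] using e

theorem W_inj {p q : ℕ} (hp : p < S.n) (hq : q < S.n) (h : S.W p = S.W q) :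
    S.f (S.J p) = S.f (S.J q) ∧ S.O p = S.O q := by
  obtain ⟨h1, h2, h3⟩ := (S.lyInf (S.hJ p hp)).unique (S.lyInf (S.hJ q hq)) (S.hO p hp) (S.hO q hq)
    (fun t => congrFun h t)
  exact ⟨S.f_ext (S.hJ p hp) (S.hJ q hq) h2 h1, h3⟩

theorem F_congr {i j : ℕ} (hi : i < S.m) (hj : j < S.m) (h : S.f i = S.f j) : S.F i = S.F j := by
  have hl : S.len i = S.len j := by unfold len; rw [h]
  funext t
  unfold F
  have h1 := Nat.mod_lt t (S.len_pos hi)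
  rw [S.c_eq i hi _ h1, S.c_eq j hj _ (show _ < S.len j by rw [← hl]; exact h1), h, hl]

theorem W_zero {p : ℕ} (hp : p < S.n) : S.W p 0 = S.c p := by
  unfold W F
  rw [Nat.add_zero, Nat.mod_eq_of_lt (S.hO' hp), ← S.hq p hp]

theorem next_JO {p : ℕ} (hp : p < S.n) :
    S.J (S.next p) = S.J p ∧ S.O (S.next p) = (S.O p + 1) % S.len (S.J p) :=
  S.JO (S.hJ p hp) (Nat.mod_lt _ (S.len_pos (S.hJ p hp)))

theorem prev_JO {p : ℕ} (hp : p < S.n) :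
    S.J (S.prev p) = S.J p ∧ S.O (S.prev p) = (S.O p + (S.len (S.J p) - 1)) % S.len (S.J p) :=
  S.JO (S.hJ p hp) (Nat.mod_lt _ (S.len_pos (S.hJ p hp)))

theorem next_lt {p : ℕ} (hp : p < S.n) : S.next p < S.n :=
  S.pos_lt (S.hJ p hp) (Nat.mod_lt _ (S.len_pos (S.hJ p hp)))

theorem prev_lt {p : ℕ} (hp : p < S.n) : S.prev p < S.n :=
  S.pos_lt (S.hJ p hp) (Nat.mod_lt _ (S.len_pos (S.hJ p hp)))

theorem next_prev {p : ℕ} (hp : p < S.n) : S.next (S.prev p) = p := by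
  have h := S.prev_JO hp
  have hl := S.len_pos (S.hJ p hp)
  unfold next
  rw [h.1, h.2, Nat.mod_add_mod, Nat.add_assoc, Nat.sub_add_cancel hl, Nat.add_mod_right,
    Nat.mod_eq_of_lt (S.hO' hp), ← S.hq p hp]

theorem prev_next {p : ℕ} (hp : p < S.n) : S.prev (S.next p) = p := by
  have h := S.next_JO hp
  have hl := S.len_pos (S.hJ p hp)
  unfold prev
  rw [h.1, h.2, Nat.mod_add_mod, Nat.add_assoc, Nat.add_sub_cancel' hl, Nat.add_mod_right,
    Nat.mod_eq_of_lt (S.hO' hp), ← S.hq p hp]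

theorem W_next {p : ℕ} (hp : p < S.n) : S.W (S.next p) = fun t => S.W p (t + 1) := by
  have h := S.next_JO hp
  funext t
  unfold W F
  rw [h.1, h.2, Nat.mod_add_mod]
  congr 3; omega

/-- sorting key of a position -/
def key (p : ℕ) : Lex ((Lex (ℕ → β)) × ℕ) := toLex (toLex (S.W p), p)

theorem key_lt {p q : ℕ} : S.key p < S.key q ↔
    toLex (S.W p) < toLex (S.W q) ∨ (S.W p = S.W q ∧ p < q) := by
  unfold key
  rw [Prod.Lex.toLex_lt_toLex]
  simp

theorem key_inj {p q : ℕ} (h : S.key p = S.key q) : p = q := by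
  unfold key at h
  simpa using congrArg (fun x => (ofLex x).2) h

theorem W_le_of_key {p q : ℕ} (h : S.key p < S.key q) : toLex (S.W p) ≤ toLex (S.W q) := by
  rcases S.key_lt.1 h with h | h
  · exact h.le
  · rw [h.1]

theorem key_next {p q : ℕ} (hp : p < S.n) (hq : q < S.n) (h : S.c p = S.c q) :
    S.key (S.next p) < S.key (S.next q) ↔ S.key p < S.key q := by
  have h0 : S.W p 0 = S.W q 0 := by rw [S.W_zero hp, S.W_zero hq, h]
  rw [S.key_lt, S.key_lt, lex_shift h0, S.W_next hp, S.W_next hq]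
  apply or_congr Iff.rfl
  have hW : ((fun t => S.W p (t + 1)) = fun t => S.W q (t + 1)) ↔ S.W p = S.W q := by
    constructor
    · intro e; funext t
      cases t with
      | zero => exact h0
      | succ t => exact congrFun e t
    · intro e; rw [e]
  rw [hW]
  apply and_congr_right
  intro e
  obtain ⟨e1, e2⟩ := S.W_inj hp hq e
  have hl : S.len (S.J p) = S.len (S.J q) := by unfold len; rw [e1]
  have a1 := S.hq p hp
  have a2 := S.hq q hq
  unfold next
  rw [e2, hl]
  rw [e2] at a1
  omega

/-- consecutive positions in the sorted order -/
def Adj (p q : ℕ) : Prop :=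
  p < S.n ∧ q < S.n ∧ S.key p < S.key q ∧ ∀ v < S.n, ¬ (S.key p < S.key v ∧ S.key v < S.key q)

theorem adj_left {p p' q : ℕ} (h : S.Adj p q) (h' : S.Adj p' q) : p = p' := by
  rcases lt_trichotomy (S.key p) (S.key p') with e | e | e
  · exact absurd ⟨e, h'.2.2.1⟩ (h.2.2.2 p' h'.1)
  · exact S.key_inj e
  · exact absurd ⟨e, h.2.2.1⟩ (h'.2.2.2 p h.1)

theorem adj_right {p q q' : ℕ} (h : S.Adj p q) (h' : S.Adj p q') : q = q' := by
  rcases lt_trichotomy (S.key q) (S.key q') with e | e | e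
  · exact absurd ⟨h.2.2.1, e⟩ (h'.2.2.2 q h.2.1)
  · exact S.key_inj e
  · exact absurd ⟨h'.2.2.1, e⟩ (h.2.2.2 q' h'.2.1)

theorem adj_of_next {p q : ℕ} (hp : p < S.n) (hq : q < S.n) (h : S.c p = S.c q)
    (ha : S.Adj (S.next p) (S.next q)) : S.Adj p q := by
  refine ⟨hp, hq, (S.key_next hp hq h).1 ha.2.2.1, ?_⟩
  rintro v hv ⟨h1, h2⟩
  have a1 := lex_head (S.W_le_of_key h1)
  have a2 := lex_head (S.W_le_of_key h2)
  rw [S.W_zero hp, S.W_zero hv] at a1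
  rw [S.W_zero hq, S.W_zero hv] at a2
  have e1 : S.c p = S.c v := le_antisymm a1 (by rw [h]; exact a2)
  exact ha.2.2.2 (S.next v) (S.next_lt hv)
    ⟨(S.key_next hp hv e1).2 h1, (S.key_next hv hq (by rw [← e1, h])).2 h2⟩

theorem adj_copy {j o : ℕ} (hj : j + 1 < S.m) (hf : S.f j = S.f (j + 1)) (ho : o < S.len j) :
    S.Adj (S.st j + o) (S.st (j + 1) + o) := by
  have hj' : j < S.m := by omega
  have hl : S.len j = S.len (j + 1) := by unfold len; rw [hf]
  have h1 := S.JO hj' ho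
  have h2 := S.JO hj (hl ▸ ho)
  have hlt := S.st_step (show j < j + 1 by omega) hj.le
  have hpos := S.len_pos hj'
  have hW : S.W (S.st j + o) = S.W (S.st (j + 1) + o) := by
    unfold W
    rw [h1.1, h1.2, h2.1, h2.2, S.F_congr hj' hj hf]
  have b1 := S.pos_lt hj' ho
  have b2 := S.pos_lt hj (hl ▸ ho)
  refine ⟨b1, b2, S.key_lt.2 (Or.inr ⟨hW, by omega⟩), ?_⟩
  rintro v hv ⟨k1, k2⟩
  have hWv : S.W (S.st j + o) = S.W v := by
    apply toLex.injective
    apply le_antisymm (S.W_le_of_key k1)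
    rw [hW]; exact S.W_le_of_key k2
  have v1 : S.st j + o < v := by
    rcases S.key_lt.1 k1 with h | h
    · rw [hWv] at h; exact absurd h (lt_irrefl _)
    · exact h.2
  have v2 : v < S.st (j + 1) + o := by
    rcases S.key_lt.1 k2 with h | h
    · rw [← hWv, hW] at h; exact absurd h (lt_irrefl _)
    · exact h.2
  obtain ⟨_, e2⟩ := S.W_inj b1 hv hWv
  have e3 := S.hq v hv
  rw [← e2, h1.2] at e3
  have hJv := S.hJ v hv
  rcases Nat.lt_or_ge j (S.J v) with h | h
  · have := S.st_mono (i := j + 1) h hJv.le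
    omega
  · have := S.st_mono h hj'.le
    omega

/-- q is copied from u -/
def Src (q u : ℕ) : Prop := q < S.n ∧ u < S.n ∧ S.c u = S.c q ∧ S.Adj (S.next u) (S.next q)

theorem Src.adj {S : PS β} {q u : ℕ} (h : S.Src q u) : S.Adj u q :=
  S.adj_of_next h.2.1 h.1 h.2.2.1 h.2.2.2

theorem src_copy {j o : ℕ} (hj : j + 1 < S.m) (hf : S.f j = S.f (j + 1)) (ho : o < S.len j) :
    S.Src (S.st (j + 1) + o) (S.st j + o) := by
  have hj' : j < S.m := by omega
  have hl : S.len j = S.len (j + 1) := by unfold len; rw [hf]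
  have h1 := S.JO hj' ho
  have h2 := S.JO hj (hl ▸ ho)
  refine ⟨S.pos_lt hj (hl ▸ ho), S.pos_lt hj' ho, ?_, ?_⟩
  · rw [S.c_eq j hj' o ho, S.c_eq (j + 1) hj o (show o < S.len (j + 1) from hl ▸ ho), hf]
  · unfold next
    rw [h1.1, h1.2, h2.1, h2.2, ← hl]
    exact S.adj_copy hj hf (Nat.mod_lt _ (S.len_pos hj'))

open Classical in
/-- literal positions -/
noncomputable def A : Finset ℕ := (Finset.range S.n).filter (fun q => ¬ ∃ u, S.Src q u)

theorem exists_src {q : ℕ} (hq : q < S.n) (h : q ∉ S.A) : ∃ u, S.Src q u := by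
  unfold A at h
  simp only [Finset.mem_filter, Finset.mem_range, not_and, not_not] at h
  exact h hq

theorem next_st {j o : ℕ} (hj : j < S.m) (ho : o + 1 < S.len j) : S.next (S.st j + o) = S.st j + o + 1 := by
  have h := S.JO hj (o := o) (by omega)
  unfold next
  rw [h.1, h.2, Nat.mod_eq_of_lt ho]; omega

/-- first copies -/
def First (j : ℕ) : Prop := j < S.m ∧ ∀ i, j = i + 1 → S.f i ≠ S.f j

theorem first_lit {j : ℕ} (h : S.First j) : ∃ o, o < S.len j ∧ S.st j + o ∈ S.A := by
  by_contra hc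
  push Not at hc
  have hj := h.1
  have hex : ∀ o, o < S.len j → ∃ u, S.Src (S.st j + o) u :=
    fun o ho => S.exists_src (S.pos_lt hj ho) (hc o ho)
  have hl := S.len_pos hj
  obtain ⟨u0, hu0⟩ := hex 0 hl
  have hu0n := hu0.2.1
  have it : ∀ t, S.Src (S.st j + t % S.len j) (S.next^[t] u0) := by
    intro t
    induction t with
    | zero => simpa using hu0
    | succ t ih =>
      obtain ⟨v, hv⟩ := hex ((t + 1) % S.len j) (Nat.mod_lt _ hl)
      have e : S.next (S.st j + t % S.len j) = S.st j + (t + 1) % S.len j := by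
        have h := S.JO hj (Nat.mod_lt t hl)
        unfold next
        rw [h.1, h.2, Nat.mod_add_mod]
      have a1 := ih.2.2.2
      rw [e] at a1
      have a2 := S.adj_left hv.adj a1
      rw [Function.iterate_succ_apply', ← a2]
      exact hv
  have itW : ∀ t p, p < S.n → S.W p t = S.c (S.next^[t] p) := by
    intro t
    induction t with
    | zero => intro p hp; simpa using S.W_zero hp
    | succ t ih =>
      intro p hp
      rw [Function.iterate_succ_apply, ← ih _ (S.next_lt hp), S.W_next hp]
  have hq := S.JO hj hl
  have hWe : S.W u0 = S.W (S.st j + 0) := by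
    funext t
    rw [itW t u0 hu0n, (it t).2.2.1]
    unfold W F
    rw [hq.1, hq.2, Nat.zero_add]
  obtain ⟨e1, e2⟩ := S.W_inj hu0n (S.pos_lt hj hl) hWe
  rw [hq.1] at e1
  rw [hq.2] at e2
  have e3 := S.hq u0 hu0n
  have hJu := S.hJ u0 hu0n
  have hlt : u0 < S.st j := by
    rcases S.key_lt.1 hu0.adj.2.2.1 with h | h
    · rw [hWe] at h; exact absurd h (lt_irrefl _)
    · simpa using h.2
  have hJlt : S.J u0 < j := by
    by_contra hge
    have := S.st_mono (not_lt.1 hge) hJu.le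
    omega
  obtain ⟨i, rfl⟩ : ∃ i, j = i + 1 := ⟨j - 1, by omega⟩
  apply h.2 i rfl
  apply le_antisymm
  · rw [← e1]; exact S.sorted _ _ (by omega) (by omega)
  · exact S.sorted _ _ (by omega) hj

open Classical in
noncomputable def D1 : Finset ℕ := (Finset.range S.m).filter (fun j => S.First j)

/-- last copies -/
def Last (j : ℕ) : Prop := j < S.m ∧ (j + 1 < S.m → S.f j ≠ S.f (j + 1))

open Classical in
noncomputable def D2 : Finset ℕ := (Finset.range S.m).filter (fun j => S.Last j)

theorem mem_D1 {j : ℕ} : j ∈ S.D1 ↔ S.First j := by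
  simp only [D1, Finset.mem_filter, Finset.mem_range]
  exact ⟨fun h => h.2, fun h => ⟨h.1, h⟩⟩

theorem mem_D2 {j : ℕ} : j ∈ S.D2 ↔ S.Last j := by
  simp only [D2, Finset.mem_filter, Finset.mem_range]
  exact ⟨fun h => h.2, fun h => ⟨h.1, h⟩⟩

theorem D1_card : S.D1.card ≤ S.A.card := by
  have h : ∀ j, ∃ o, S.First j → o < S.len j ∧ S.st j + o ∈ S.A := by
    intro j
    by_cases hj : S.First j
    · obtain ⟨o, ho⟩ := S.first_lit hj
      exact ⟨o, fun _ => ho⟩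
    · exact ⟨0, fun h => absurd h hj⟩
  choose g hg using h
  apply Finset.card_le_card_of_injOn (fun j => S.st j + g j)
  · intro j hj
    simp only [D1, Finset.coe_filter, Finset.mem_range, Set.mem_ofPred_eq] at hj
    exact (hg j hj.2).2
  · intro i hi j hj hij
    simp only [D1, Finset.coe_filter, Finset.mem_range, Set.mem_ofPred_eq] at hi hj
    exact (S.JO_unique hi.1 hj.1 (hg i hi.2).1 (hg j hj.2).1 hij).1

theorem D2_card : S.D2.card ≤ S.D1.card := by
  apply Finset.card_le_card_of_injOn (fun j => if j + 1 < S.m then j + 1 else 0)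
  · intro j hj
    have hj := S.mem_D2.1 hj
    apply S.mem_D1.2
    dsimp only
    split_ifs with h
    · refine ⟨h, ?_⟩
      intro i hi
      have : i = j := by omega
      subst this
      exact hj.2 h
    · exact ⟨by have := hj.1; omega, fun i hi => by omega⟩
  · intro i hi j hj hij
    simp only [D2, Finset.coe_filter, Finset.mem_range, Set.mem_ofPred_eq] at hi hj hij
    split_ifs at hij <;> omega

open Classical in
noncomputable def src (q : ℕ) : Option ℕ := if h : ∃ u, S.Src q u then some h.choose else none

theorem src_some {q u : ℕ} : S.src q = some u ↔ S.Src q u := by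
  unfold src
  split_ifs with h
  · rw [Option.some_inj]
    constructor
    · intro e; rw [← e]; exact h.choose_spec
    · intro e; exact S.adj_left h.choose_spec.adj e.adj
  · simp only [false_iff]
    exact fun e => h ⟨u, e⟩

open Classical in
/-- positions whose source is the start of a last copy -/
noncomputable def S3 : Finset ℕ := (Finset.range S.n).filter (fun q => ∃ j ∈ S.D2, S.Src q (S.st j))

theorem S3_card : S.S3.card ≤ S.D2.card := by
  have h : ∀ q, ∃ j, q ∈ S.S3 → j ∈ S.D2 ∧ S.Src q (S.st j) := by
    intro q
    by_cases hq : q ∈ S.S3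
    · have := hq
      simp only [S3, Finset.mem_filter] at this
      obtain ⟨_, j, hj⟩ := this
      exact ⟨j, fun _ => hj⟩
    · exact ⟨0, fun h => absurd h hq⟩
  choose g hg using h
  apply Finset.card_le_card_of_injOn g
  · intro q hq
    exact (hg q hq).1
  · intro p hp q hq hpq
    have h1 := (hg p hp).2.adj
    have h2 := (hg q hq).2.adj
    rw [hpq] at h1
    exact S.adj_right h1 h2

/-- break positions -/
noncomputable def B : Finset ℕ :=
  S.A ∪ S.A.image (· + 1) ∪ S.D1.image S.st ∪ S.D1.image (fun j => S.st (j + 1)) ∪ S.S3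

theorem B_card : S.B.card ≤ 5 * S.A.card := by
  have h1 := S.D1_card
  have h2 := S.D2_card
  have h3 := S.S3_card
  have i1 : (S.A.image (· + 1)).card ≤ S.A.card := Finset.card_image_le
  have i2 : (S.D1.image S.st).card ≤ S.D1.card := Finset.card_image_le
  have i3 : (S.D1.image (fun j => S.st (j + 1))).card ≤ S.D1.card := Finset.card_image_le
  unfold B
  have u1 := Finset.card_union_le (S.A ∪ S.A.image (· + 1) ∪ S.D1.image S.st ∪ S.D1.image (fun j => S.st (j + 1))) S.S3
  have u2 := Finset.card_union_le (S.A ∪ S.A.image (· + 1) ∪ S.D1.image S.st) (S.D1.image (fun j => S.st (j + 1)))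
  have u3 := Finset.card_union_le (S.A ∪ S.A.image (· + 1)) (S.D1.image S.st)
  have u4 := Finset.card_union_le S.A (S.A.image (· + 1))
  omega

theorem zero_mem_B (h : 0 < S.n) : 0 ∈ S.B := by
  have hm : 0 < S.m := by
    by_contra hc
    have h0 : S.m = 0 := by omega
    have := S.st_m
    rw [h0, S.st_zero] at this
    omega
  have : 0 ∈ S.D1.image S.st :=
    Finset.mem_image.2 ⟨0, S.mem_D1.2 ⟨hm, fun i hi => by omega⟩, S.st_zero⟩
  simp only [B, Finset.mem_union]
  tauto

theorem not_break {q : ℕ} (hq : q < S.n) (hB : q ∉ S.B) :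
    ∃ q0 s, q = q0 + 1 ∧ S.src q0 = some s ∧ S.src q = some (s + 1) := by
  have hq0 : q ≠ 0 := by
    rintro rfl; exact hB (S.zero_mem_B hq)
  obtain ⟨q0, rfl⟩ : ∃ q0, q = q0 + 1 := ⟨q - 1, by omega⟩
  simp only [B, Finset.mem_union, not_or] at hB
  obtain ⟨⟨⟨⟨hA, hA1⟩, hD1⟩, hD2⟩, hS3⟩ := hB
  have hA0 : q0 ∉ S.A := fun h => hA1 (Finset.mem_image.2 ⟨q0, h, rfl⟩)
  have hq0n : q0 < S.n := by omega
  obtain ⟨u, hu⟩ := S.exists_src hq hA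
  obtain ⟨v, hv⟩ := S.exists_src hq0n hA0
  refine ⟨q0, v, rfl, S.src_some.2 hv, ?_⟩
  suffices h : u = v + 1 by rw [← h]; exact S.src_some.2 hu
  have hj := S.hJ _ hq
  have hO := S.hO _ hq
  have hqe := S.hq _ hq
  generalize S.J (q0 + 1) = j at hj hO hqe
  generalize S.O (q0 + 1) = o at hO hqe
  have hO' : o < S.len j := hO
  rcases Nat.eq_zero_or_pos o with ho | ho
  · -- start of a factor
    subst ho
    have hnf : ¬ S.First j := fun h => hD1 (Finset.mem_image.2 ⟨j, S.mem_D1.2 h, by omega⟩)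
    obtain ⟨i, rfl, hi⟩ : ∃ i, j = i + 1 ∧ S.f i = S.f j := by
      by_contra hc
      push Not at hc
      exact hnf ⟨hj, hc⟩
    have hnf2 : ¬ S.First i := fun h => hD2 (Finset.mem_image.2 ⟨i, S.mem_D1.2 h, by omega⟩)
    obtain ⟨k, rfl, hk⟩ : ∃ k, i = k + 1 ∧ S.f k = S.f i := by
      by_contra hc
      push Not at hc
      exact hnf2 ⟨by omega, hc⟩
    have hm1 : k + 1 < S.m := by omega
    have hl1 : S.len (k + 1) = S.len (k + 1 + 1) := by unfold len; rw [hi]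
    have hl0 : S.len k = S.len (k + 1) := by unfold len; rw [hk]
    have hp := S.len_pos hm1
    have s1 : S.st (k + 1 + 1) = S.st (k + 1) + S.len (k + 1) := S.st_succ _ hm1
    have s0 : S.st (k + 1) = S.st k + S.len k := S.st_succ _ (by omega)
    have c1 := S.src_copy hj hi hp
    have c0 := S.src_copy (o := S.len k - 1) hm1 hk (by omega)
    rw [← hqe] at c1
    have e0 : S.st (k + 1) + (S.len k - 1) = q0 := by omega
    rw [e0] at c0
    have := S.adj_left hu.adj c1.adj
    have := S.adj_left hv.adj c0.adj
    omega
  · have hnx : S.next q0 = q0 + 1 := by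
      have := S.next_st hj (o := o - 1) (by omega)
      rwa [show S.st j + (o - 1) = q0 by omega] at this
    have ha := hv.2.2.2
    rw [hnx] at ha
    have huv : u = S.next v := S.adj_left hu.adj ha
    have hvn := hv.2.1
    have hJv := S.hJ v hvn
    have hOv : S.O v < S.len (S.J v) := S.hO v hvn
    have hve := S.hq v hvn
    rcases Nat.lt_or_ge (S.O v + 1) (S.len (S.J v)) with h | h
    · have := S.next_st hJv h
      rw [← hve] at this
      omega
    · exfalso
      have hus : u = S.st (S.J v) := by
        rw [huv]; unfold next
        rw [show S.O v + 1 = S.len (S.J v) by omega, Nat.mod_self, Nat.add_zero]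
      generalize S.J v = i at hJv hus
      by_cases hl : S.Last i
      · apply hS3
        simp only [S3, Finset.mem_filter, Finset.mem_range]
        exact ⟨hq, i, S.mem_D2.2 hl, hus ▸ hu⟩
      · have : i + 1 < S.m ∧ S.f i = S.f (i + 1) := by
          by_contra hc
          exact hl ⟨hJv, fun h1 h2 => hc ⟨h1, h2⟩⟩
        have c1 := S.adj_copy this.1 this.2 (S.len_pos hJv)
        have hua := hu.adj
        rw [hus] at hua
        have e := S.adj_right hua c1
        have hp := S.len_pos this.1
        have := S.JO_unique hj this.1 hO' hp (by omega)
        omega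

/-- rank of a position -/
noncomputable def rk (q : ℕ) : ℕ := ((Finset.range S.n).filter (fun v => S.key v < S.key q)).card

theorem rk_lt {q u : ℕ} (h : S.Src q u) : S.rk u < S.rk q := by
  have ha := h.adj
  apply Finset.card_lt_card
  rw [Finset.ssubset_iff_of_subset]
  · exact ⟨u, by simp [ha.1, ha.2.2.1], by simp⟩
  · intro v hv
    simp only [Finset.mem_filter] at hv ⊢
    exact ⟨hv.1, hv.2.trans ha.2.2.1⟩

theorem bms (w : List β) (hw : w.length = S.n) (hc : ∀ q < S.n, w[q]? = some (S.c q)) :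
    ∃ ps : List (Phrase β), IsBMS w ps ∧ ps.length ≤ 5 * S.A.card := by
  obtain ⟨ps, h1, h2, h3, h4⟩ := bms_build w S.src (by
      intro q s h
      have h := S.src_some.1 h
      exact ⟨hw ▸ h.2.1, by rw [hc q h.1, hc s h.2.1, h.2.2.1]⟩) S.B
    (fun q hq hB => S.not_break (hw ▸ hq) hB) w.length 0 (by simp) (fun h => S.zero_mem_B (hw ▸ h))
  refine ⟨ps, ⟨h1, ?_, S.rk, ?_⟩, ?_⟩
  · intro k hk
    simpa using h2 k hk
  · intro q q' h
    have := h3 q q' h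
    rw [Nat.zero_add] at this
    exact S.rk_lt (S.src_some.1 this)
  · have := S.B_card
    simp at h4
    omega

theorem A_card (L : List ℕ) (hp : L.Perm (List.range S.n))
    (hs : L.Pairwise (fun a b => S.key a < S.key b)) (hn : 0 < S.n) :
    S.A.card ≤ runCount (L.map (fun p => S.c (S.prev p))) := by
  have hlen : L.length = S.n := by simpa using hp.length_eq
  have hmem : ∀ q, q ∈ L ↔ q < S.n := fun q => by rw [hp.mem_iff, List.mem_range]
  obtain ⟨x, l, rfl⟩ : ∃ x l, L = x :: l := by
    cases L with
    | nil => simp at hlen; omega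
    | cons x l => exact ⟨x, l, rfl⟩
  have hr := run_aux (l.map (fun p => S.c (S.prev p))) (S.c (S.prev x))
  rw [← List.map_cons (f := fun p => S.c (S.prev p))] at hr
  have hr' : runCount ((x :: l).map (fun p => S.c (S.prev p))) =
    (List.destutter' (· ≠ ·) (S.c (S.prev x)) (l.map (fun p => S.c (S.prev p)))).length := rfl
  rw [hr']
  refine le_trans ?_ hr
  rw [List.length_map]
  generalize hL : x :: l = L at *
  have hll : L.length = l.length + 1 := by rw [← hL]; simp
  set K := (Finset.range l.length).filter (fun k => (L.map (fun p => S.c (S.prev p)))[k]? ≠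
    (L.map (fun p => S.c (S.prev p)))[k + 1]?) with hK
  have hK2 : (insert 0 (K.image (· + 1))).card ≤ K.card + 1 :=
    (Finset.card_insert_le _ _).trans (Nat.add_le_add_right Finset.card_image_le 1)
  refine le_trans ?_ hK2
  have hAn : ∀ q ∈ S.A, q < S.n := by
    intro q hq
    simp only [A, Finset.mem_filter, Finset.mem_range] at hq
    exact hq.1
  apply Finset.card_le_card_of_injOn (fun q => L.idxOf (S.next q))
  · intro q hq
    have hqn := hAn q hq
    have hnx := S.next_lt hqn
    have hidx : L.idxOf (S.next q) < L.length := List.idxOf_lt_length_iff.2 ((hmem _).2 hnx)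
    have hget : L[L.idxOf (S.next q)] = S.next q := List.getElem_idxOf hidx
    simp only [Finset.coe_insert, Finset.coe_image, Set.mem_insert_iff, Set.mem_image, Finset.mem_coe]
    generalize L.idxOf (S.next q) = k at hidx hget
    cases k with
    | zero => exact Or.inl rfl
    | succ k =>
      right
      refine ⟨k, ?_, rfl⟩
      rw [hK, Finset.mem_filter, Finset.mem_range]
      refine ⟨by omega, ?_⟩
      intro e
      have hk : k < L.length := by omega
      rw [List.getElem?_map, List.getElem?_map, List.getElem?_eq_getElem hk,
        List.getElem?_eq_getElem hidx, hget] at e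
      simp only [Option.map_some, Option.some_inj] at e
      rw [S.prev_next hqn] at e
      have hpn : L[k] < S.n := (hmem _).1 (List.getElem_mem hk)
      have hmono : ∀ i j (hi : i < L.length) (hj : j < L.length), i < j → S.key L[i] < S.key L[j] := by
        intro i j hi hj hij
        exact List.pairwise_iff_getElem.1 hs i j hi hj hij
      have : S.Src q (S.prev L[k]) := by
        refine ⟨hqn, S.prev_lt hpn, e, ?_⟩
        rw [S.next_prev hpn]
        refine ⟨hpn, hnx, ?_, ?_⟩
        · rw [← hget]; exact hmono _ _ _ _ (Nat.lt_succ_self k)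
        · rintro v hv ⟨k1, k2⟩
          obtain ⟨i, hi, rfl⟩ := List.getElem_of_mem ((hmem v).2 hv)
          rw [← hget] at k2
          have i1 : k < i := by
            by_contra hc
            rcases Nat.lt_or_eq_of_le (not_lt.1 hc) with h | h
            · exact absurd k1 (hmono _ _ hi hk h).asymm
            · subst h; exact absurd k1 (lt_irrefl _)
          have i2 : i < k + 1 := by
            by_contra hc
            rcases Nat.lt_or_eq_of_le (not_lt.1 hc) with h | h
            · exact absurd k2 (hmono _ _ hidx hi h).asymm
            · subst h; exact absurd k2 (lt_irrefl _)
          omega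
      simp only [A, Finset.mem_coe, Finset.mem_filter] at hq
      exact hq.2 ⟨_, this⟩
  · intro p hp q hq hpq
    have h1 := S.next_lt (hAn p hp)
    have h2 := S.next_lt (hAn q hq)
    have : S.next p = S.next q := (List.idxOf_inj ((hmem _).2 h1)).1 hpq
    rw [← S.prev_next (hAn p hp), this, S.prev_next (hAn q hq)]

/-- rotation of the factor starting at position p -/
def rot (p : ℕ) : List β := (S.f (S.J p)).drop (S.O p) ++ (S.f (S.J p)).take (S.O p)

theorem rot_length {p : ℕ} (hp : p < S.n) : (S.rot p).length = S.len (S.J p) := by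
  have := S.hO' hp
  unfold len at *
  simp [rot]; omega

theorem rot_get {p : ℕ} (hp : p < S.n) {t : ℕ} (ht : t < S.len (S.J p)) :
    (S.rot p)[t]? = some (S.F (S.J p) (S.O p + t)) := by
  have hO := S.hO' hp
  have e : S.rot p = (S.f (S.J p)).rotate (S.O p) :=
    (List.rotate_eq_drop_append_take (le_of_lt hO)).symm
  have hm := Nat.mod_lt (S.O p + t) (S.len_pos (S.hJ p hp))
  rw [e, List.getElem?_rotate ht, Nat.add_comm t]
  unfold F
  rw [S.c_eq _ (S.hJ p hp) _ hm]
  have hm' : (S.O p + t) % (S.f (S.J p)).length < (S.f (S.J p)).length := hm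
  unfold len
  simp [hm']

theorem inf_rot {p : ℕ} (hp : p < S.n) : inf S.a0 (S.rot p) = S.W p := by
  funext t
  unfold inf W
  have h := Nat.mod_lt t (S.len_pos (S.hJ p hp))
  rw [S.rot_length hp, List.getD_eq_getElem?_getD, S.rot_get hp h, Option.getD_some]
  unfold F
  rw [Nat.add_mod_mod]

theorem rot_last {p : ℕ} (hp : p < S.n) : (S.rot p).getLast? = some (S.c (S.prev p)) := by
  have hl := S.len_pos (S.hJ p hp)
  rw [List.getLast?_eq_getElem?, S.rot_length hp, S.rot_get hp (by omega)]
  rfl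

theorem rot_congr {p q : ℕ} (hp : p < S.n) (hq : q < S.n) (h : S.W p = S.W q) : S.rot p = S.rot q := by
  obtain ⟨h1, h2⟩ := S.W_inj hp hq h
  unfold rot
  rw [h1, h2]

theorem omega_rot {p q : ℕ} (hp : p < S.n) (hq : q < S.n) :
    omegaLE (S.rot p) (S.rot q) ↔ toLex (S.W p) ≤ toLex (S.W q) := by
  have ne : ∀ p, p < S.n → S.rot p ≠ [] := by
    intro p hp h
    have := S.rot_length hp
    rw [h] at this
    have := S.len_pos (S.hJ p hp)
    simp at *; omega
  rw [omegaLE_iff S.a0 _ _ (ne p hp) (ne q hq), S.inf_rot hp, S.inf_rot hq]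

theorem pairwise_insertionSort (l : List ℕ) (hl : ∀ p ∈ l, p < S.n) :
    (List.insertionSort omegaLE (l.map S.rot)).Pairwise omegaLE := by
  have e : List.insertionSort omegaLE (l.map S.rot) =
      (List.insertionSort (fun p q => toLex (S.W p) ≤ toLex (S.W q)) l).map S.rot := by
    classical
    exact (List.map_insertionSort (r := fun p q => toLex (S.W p) ≤ toLex (S.W q)) (s := omegaLE) S.rot l
      (fun a ha b hb => (S.omega_rot (hl a ha) (hl b hb)).symm)).symm
  rw [e, List.pairwise_map]
  have : IsTrans ℕ (fun p q => toLex (S.W p) ≤ toLex (S.W q)) := ⟨fun _ _ _ h1 h2 => h1.trans h2⟩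
  have : Std.Total (fun p q => toLex (S.W p) ≤ toLex (S.W q)) := ⟨fun _ _ => le_total _ _⟩
  refine List.Pairwise.imp_of_mem ?_ (List.pairwise_insertionSort (fun p q => toLex (S.W p) ≤ toLex (S.W q)) l)
  intro a b ha hb h
  rw [List.mem_insertionSort] at ha hb
  exact (S.omega_rot (hl a ha) (hl b hb)).2 h

theorem final (fs : List (List β)) (hR : fs.flatMap rotations = (List.range S.n).map S.rot)
    (hn : 0 < S.n) : S.A.card ≤ runCount (BBWTof fs) := by
  have : IsTrans ℕ (fun p q => S.key p ≤ S.key q) := ⟨fun _ _ _ h1 h2 => h1.trans h2⟩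
  have : Std.Total (fun p q => S.key p ≤ S.key q) := ⟨fun _ _ => le_total _ _⟩
  set L := List.insertionSort (fun p q => S.key p ≤ S.key q) (List.range S.n) with hL
  have hperm : L.Perm (List.range S.n) := List.perm_insertionSort _ _
  have hmem : ∀ q, q ∈ L → q < S.n := fun q h => by rwa [hperm.mem_iff, List.mem_range] at h
  have hs0 : L.Pairwise (fun p q => S.key p ≤ S.key q) := List.pairwise_insertionSort _ _
  have hnd : L.Nodup := hperm.nodup_iff.2 List.nodup_range
  have hs : L.Pairwise (fun p q => S.key p < S.key q) := by
    refine (hs0.and hnd).imp ?_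
    rintro a b ⟨h1, h2⟩
    exact lt_of_le_of_ne h1 (fun h => h2 (S.key_inj h))
  have hB : List.insertionSort omegaLE (fs.flatMap rotations) = L.map S.rot := by
    rw [hR]
    apply List.Perm.eq_of_pairwise (le := omegaLE)
    · intro a b ha hb h1 h2
      rw [List.mem_insertionSort] at ha
      obtain ⟨p, hp, rfl⟩ := List.mem_map.1 ha
      obtain ⟨q, hq, rfl⟩ := List.mem_map.1 hb
      rw [List.mem_range] at hp
      have hq := hmem q hq
      apply S.rot_congr hp hq
      exact toLex.injective (le_antisymm ((S.omega_rot hp hq).1 h1) ((S.omega_rot hq hp).1 h2))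
    · exact S.pairwise_insertionSort _ (fun p hp => by simpa using hp)
    · rw [List.pairwise_map]
      refine List.Pairwise.imp_of_mem ?_ hs
      intro a b ha hb h
      exact (S.omega_rot (hmem a ha) (hmem b hb)).2 (S.W_le_of_key h)
    · exact (List.perm_insertionSort _ _).trans (hperm.map _).symm
  have hBB : BBWTof fs = L.map (fun p => S.c (S.prev p)) := by
    unfold BBWTof
    rw [hB]
    clear_value L
    clear hL hs hs0 hnd hB hperm
    induction L with
    | nil => rfl
    | cons x l ih =>
      rw [List.map_cons, List.map_cons, List.flatMap_cons, S.rot_last (hmem x (by simp)),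
        ih (fun q h => hmem q (by simp [h]))]
      rfl
  rw [hBB]
  exact S.A_card L hperm hs hn

end PS

theorem build {β : Type} [LinearOrder β] (w : List β) (hw : w ≠ []) (fs : List (List β))
    (h : IsLyndonFactorization w fs) :
    ∃ S : PS β, S.n = w.length ∧ (∀ q < S.n, w[q]? = some (S.c q)) ∧
      fs.flatMap rotations = (List.range S.n).map S.rot := by
  obtain ⟨hfl, hly, hch⟩ := h
  obtain ⟨a0, _⟩ := List.exists_mem_of_ne_nil w hw
  let st : ℕ → ℕ := fun j => ((fs.take j).map List.length).sum
  let f : ℕ → List β := fun j => fs.getD j []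
  have hf : ∀ j (hj : j < fs.length), f j = fs[j] := by intro j hj; simp [f, hj]
  have st_succ : ∀ j < fs.length, st (j + 1) = st j + (f j).length := by
    intro j hj
    rw [hf j hj]
    simp only [st]
    rw [List.take_succ_eq_append_getElem hj, List.map_append, List.sum_append]
    rfl
  have st_m : st fs.length = w.length := by
    simp only [st]
    rw [List.take_length, ← hfl, List.length_flatten]
  have hw' : ∀ j (hj : j < fs.length), w = (fs.take j).flatten ++ (f j ++ (fs.drop (j + 1)).flatten) := by
    intro j hj
    rw [hf j hj, ← List.flatten_cons, ← List.drop_eq_getElem_cons hj, ← List.flatten_append,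
      List.take_append_drop, hfl]
  have ex : ∀ i ≤ fs.length, ∀ q < st i, ∃ j o, j < fs.length ∧ o < (f j).length ∧ q = st j + o := by
    intro i
    induction i with
    | zero => intro _ q hq; simp [st] at hq
    | succ i ih =>
      intro hi q hq
      rcases Nat.lt_or_ge q (st i) with h | h
      · exact ih (by omega) q h
      · rw [st_succ i (by omega)] at hq
        exact ⟨i, q - st i, by omega, by omega, by omega⟩
  have ex' : ∀ q, ∃ j o, q < w.length → j < fs.length ∧ o < (f j).length ∧ q = st j + o := by
    intro q
    by_cases hq : q < w.length
    · obtain ⟨j, o, h⟩ := ex fs.length le_rfl q (by rw [st_m]; exact hq)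
      exact ⟨j, o, fun _ => h⟩
    · exact ⟨0, 0, fun h => absurd h hq⟩
  choose J O hJO using ex'
  have hsort : fs.Pairwise (fun a b => b ≤ a) := by
    have : IsTrans (List β) (fun a b => b ≤ a) := ⟨fun _ _ _ h1 h2 => le_trans h2 h1⟩
    exact List.isChain_iff_pairwise.1 hch
  let S : PS β :=
    { m := fs.length
      n := w.length
      a0 := a0
      st := st
      f := f
      c := fun q => w.getD q a0
      J := J
      O := O
      st_zero := by simp [st]
      st_m := st_m
      st_succ := st_succ
      lyn := fun j hj => by rw [hf j hj]; exact hly _ (List.getElem_mem hj)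
      c_eq := by
        intro j hj o ho
        rw [List.getD_eq_getElem?_getD, List.getD_eq_getElem?_getD, hw' j hj]
        have hl : st j = (fs.take j).flatten.length := by rw [List.length_flatten]
        rw [List.getElem?_append_right (by omega), hl, Nat.add_sub_cancel_left,
          List.getElem?_append_left ho]
      hJ := fun q hq => (hJO q hq).1
      hO := fun q hq => (hJO q hq).2.1
      hq := fun q hq => (hJO q hq).2.2
      sorted := by
        intro i j hij hj
        rcases Nat.lt_or_eq_of_le hij with h | h
        · rw [hf i (by omega), hf j hj]
          exact List.pairwise_iff_getElem.1 hsort i j (by omega) hj h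
        · rw [h] }
  refine ⟨S, rfl, ?_, ?_⟩
  · intro q hq
    have hq' : q < w.length := hq
    simp [S, hq']
  · have main : ∀ j ≤ fs.length, (fs.take j).flatMap rotations = (List.range (st j)).map S.rot := by
      intro j
      induction j with
      | zero => intro _; simp [st]
      | succ j ih =>
        intro hj
        have hj' : j < S.m := hj
        rw [List.take_succ_eq_append_getElem hj, List.flatMap_append, ih (by omega),
          st_succ j hj, List.range_add, List.map_append, List.flatMap_singleton, ← hf j hj]
        congr 1
        unfold rotations
        rw [List.map_map]
        apply List.map_congr_left
        intro o ho
        have h := S.JO hj' (List.mem_range.1 ho)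
        have h1 : S.J (st j + o) = j := h.1
        have h2 : S.O (st j + o) = o := h.2
        simp only [Function.comp, PS.rot, h1, h2]
        rfl
    have := main fs.length le_rfl
    rwa [List.take_length, st_m] at this

end BB

/-- There is a universal constant `C` such that every nonempty string `w`
admits a valid bidirectional macro scheme of size at most `C · r_B(w)`. -/
theorem exists_bms_of_size_bbwt_runs :
    ∃ C : ℕ, 0 < C ∧ ∀ (α : Type) [LinearOrder α] (w : List α), w ≠ [] →
      ∀ fs, IsLyndonFactorization w fs →
        ∃ ps : List (Phrase α), IsBMS w ps ∧ ps.length ≤ C * runCount (BBWTof fs) := by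
  refine ⟨5, by norm_num, ?_⟩
  intro α _ w hw fs h
  obtain ⟨S, h1, h2, h3⟩ := BB.build w hw fs h
  obtain ⟨ps, hps, hl⟩ := S.bms w h1.symm h2
  refine ⟨ps, hps, hl.trans (Nat.mul_le_mul_left _ (S.final fs h3 ?_))⟩
  rw [h1]
  exact List.length_pos_iff.2 hw
end

section
/- There exists a universal constant C such that for every string w of length n ≥ 2, r_B(w) ≤ C · z(w) · (log n)², where z(w) is the number of phrases of the Lempel–Ziv 77 factorization of w. -/
open List

variable {α : Type*} [LinearOrder α]

/-- `ps` is the Lempel–Ziv 77 factorization of `w`: the phrases concatenate to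
`w`, and each phrase is either a single character not occurring earlier in `w`,
or the longest prefix of the remaining suffix of `w` that also occurs in `w`
starting at some position strictly before the start of the phrase. -/
def IsLZ77 (w : List α) (ps : List (List α)) : Prop :=
  ps.flatten = w ∧ (∀ p ∈ ps, p ≠ []) ∧
  ∀ k (hk : k < ps.length),
    (ps[k].length = 1 ∧ ∀ c ∈ ps[k], c ∉ (ps.take k).flatten) ∨
    ((∃ s < ((ps.take k).flatten).length, ps[k] <+: w.drop s) ∧
      ∀ q, q <+: w.drop ((ps.take k).flatten).length →
        (∃ s < ((ps.take k).flatten).length, q <+: w.drop s) →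
        q.length ≤ ps[k].length)

set_option linter.unusedSectionVars false

/-! ### Infinite words -/

/-- The length `m` window at the start of an infinite word. -/
def win (u : ℕ → α) (m : ℕ) : List α := (List.range m).map u

lemma win_eq_iff (u v : ℕ → α) (m : ℕ) : win u m = win v m ↔ ∀ t < m, u t = v t := by
  simp [win]

/-- Lexicographic order on infinite words. -/
def lexLE (a b : ℕ → α) : Prop := ∀ t, (∀ s < t, a s = b s) → a t ≤ b t

lemma lexLE_sandwich {a b c : ℕ → α} (hab : lexLE a b) (hbc : lexLE b c) (M : ℕ)
    (hac : ∀ t < M, a t = c t) : ∀ t < M, a t = b t := by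
  intro t
  induction t using Nat.strong_induction_on with
  | _ t ih =>
    intro ht
    have h1 : ∀ s < t, a s = b s := fun s hs => ih s hs (hs.trans ht)
    have h2 : ∀ s < t, b s = c s := fun s hs => (h1 s hs).symm.trans (hac s (hs.trans ht))
    have h3 := hab t h1
    have h4 := hbc t h2
    rw [← hac t ht] at h4
    exact le_antisymm h3 h4

lemma lexLE_trans {a b c : ℕ → α} (hab : lexLE a b) (hbc : lexLE b c) : lexLE a c := by
  intro t ht
  have h1 := lexLE_sandwich hab hbc t ht
  refine (hab t h1).trans (hbc t fun s hs => (h1 s hs).symm.trans (ht s hs))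

lemma lexLE_total (a b : ℕ → α) : lexLE a b ∨ lexLE b a := by
  by_contra! h
  obtain ⟨h1, h2⟩ := h
  unfold lexLE at h1 h2
  push Not at h1 h2
  obtain ⟨t, ht, h1⟩ := h1
  obtain ⟨s, hs, h2⟩ := h2
  rcases lt_trichotomy t s with h | h | h
  · exact absurd (hs t h) (ne_of_lt h1)
  · subst h; exact absurd h1 (not_lt.2 h2.le)
  · exact absurd (ht s h) (ne_of_lt h2)

lemma double_count (g : ℕ → ℕ) (h0 : 1 ≤ g 0) (hg : ∀ k, g k ≤ g (k + 1)) (j : ℕ) :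
    2 ^ ((Finset.Icc 1 j).filter fun k => 2 * g (k - 1) ≤ g k).card ≤ g j := by
  induction j with
  | zero => simpa using h0
  | succ j ih =>
    rw [← Finset.insert_Icc_right_eq_Icc_add_one (by omega), Finset.filter_insert]
    split_ifs with h
    · rw [Finset.card_insert_of_notMem (by simp), pow_succ]
      simp only [Nat.add_sub_cancel] at h
      omega
    · exact ih.trans (hg j)

section Abstract

variable {N : ℕ} (key : Fin N → ℕ → α)

lemma pair_determined (mono : ∀ r s, r ≤ s → lexLE (key r) (key s)) (M : ℕ)
    (p q : Fin N × Fin N) (hp : p.1.val + 1 = p.2.val) (hq : q.1.val + 1 = q.2.val)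
    (hpd : ∃ m < M, key p.1 m ≠ key p.2 m) (hqd : ∃ m < M, key q.1 m ≠ key q.2 m)
    (h : (∀ t < M, key p.1 t = key q.1 t) ∨ (∀ t < M, key p.2 t = key q.2 t)) : p = q := by
  wlog hlt : p.1 < q.1 generalizing p q
  · rcases (not_lt.1 hlt).lt_or_eq with h' | h'
    · refine (this q p hq hp hqd hpd ?_ h').symm
      exact h.imp (fun h t ht => (h t ht).symm) (fun h t ht => (h t ht).symm)
    · have : p.2 = q.2 := by
        apply Fin.ext
        rw [← hp, ← hq, h']
      exact Prod.ext h'.symm this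
  exfalso
  have h1 : p.1 ≤ p.2 := by rw [Fin.le_def]; omega
  have h2 : p.2 ≤ q.1 := by rw [Fin.le_def]; rw [Fin.lt_def] at hlt; omega
  have h3 : q.1 ≤ q.2 := by rw [Fin.le_def]; omega
  rcases h with h | h
  · obtain ⟨m, hm, hne⟩ := hpd
    exact hne (lexLE_sandwich (mono _ _ h1) (mono _ _ h2) M h m hm)
  · obtain ⟨m, hm, hne⟩ := hqd
    have := lexLE_sandwich (mono _ _ h2) (mono _ _ h3) M h m hm
    exact hne (this.symm.trans (h m hm))

/-- Number of words agreeing with word number `z` on `[k, l)`. -/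
def cnt (l : ℕ) (z : Fin N) (k : ℕ) : ℕ :=
  (Finset.univ.filter fun x => ∀ t, k ≤ t → t < l → key x t = key z t).card

lemma cnt_congr (l : ℕ) (z z' : Fin N) (k : ℕ) (h : ∀ t < l, key z t = key z' t) :
    cnt key l z k = cnt key l z' k := by
  unfold cnt
  congr 1
  ext x
  simp only [Finset.mem_filter, Finset.mem_univ, true_and]
  exact ⟨fun H t h1 h2 => (H t h1 h2).trans (h t h2),
    fun H t h1 h2 => (H t h1 h2).trans (h t h2).symm⟩

lemma cnt_add (l : ℕ) (z z' : Fin N) (k : ℕ) (hk : 1 ≤ k) (hkl : k ≤ l)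
    (h : ∀ t, k ≤ t → t < l → key z t = key z' t)
    (hne : key z (k-1) ≠ key z' (k-1)) :
    cnt key l z (k-1) + cnt key l z' (k-1) ≤ cnt key l z k := by
  unfold cnt
  rw [← Finset.card_union_of_disjoint]
  · apply Finset.card_le_card
    intro x
    simp only [Finset.mem_union, Finset.mem_filter, Finset.mem_univ, true_and]
    rintro (H | H) t h1 h2
    · exact H t (by omega) h2
    · exact (H t (by omega) h2).trans (h t h1 h2).symm
  · rw [Finset.disjoint_left]
    intro x
    simp only [Finset.mem_filter, Finset.mem_univ, true_and]
    intro h1 h2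
    exact hne ((h1 (k-1) le_rfl (by omega)).symm.trans (h2 (k-1) le_rfl (by omega)))

lemma light_card (l : ℕ) (z : Fin N) :
    ((Finset.Icc 1 l).filter fun k => 2 * cnt key l z (k - 1) ≤ cnt key l z k).card
      ≤ Nat.log 2 N := by
  have h := double_count (cnt key l z) (by
    unfold cnt
    exact Finset.card_pos.2 ⟨z, by simp⟩) (by
    intro k
    unfold cnt
    apply Finset.card_le_card
    intro x
    simp only [Finset.mem_filter, Finset.mem_univ, true_and]
    intro H t h1 h2
    exact H t (by omega) h2) l
  have h2 : cnt key l z l ≤ N := by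
    unfold cnt
    exact (Finset.card_le_univ _).trans (by simp)
  have hN : N ≠ 0 := by have := z.2; omega
  exact (Nat.le_log_iff_pow_le (by norm_num) hN).2 (h.trans h2)

lemma key_iter (prev : Fin N → Fin N) (hprev : ∀ y t, key (prev y) (t+1) = key y t) (k : ℕ)
    (y : Fin N) (t : ℕ) : key (prev^[k] y) (t + k) = key y t := by
  induction k generalizing y t with
  | zero => rfl
  | succ k ih =>
    rw [Function.iterate_succ_apply, show t + (k+1) = (t + 1) + k by ring, ih, hprev]

lemma level_bound (mono : ∀ r s, r ≤ s → lexLE (key r) (key s))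
    (prev : Fin N → Fin N) (hprev : ∀ y t, key (prev y) (t+1) = key y t)
    (l : ℕ) (R : Finset (Fin N × Fin N))
    (hR : ∀ p ∈ R, p.1.val + 1 = p.2.val ∧ key (prev p.1) 0 ≠ key (prev p.2) 0 ∧
      ∃ m, l ≤ m ∧ m < 2 * l ∧ (∀ t < m, key p.1 t = key p.2 t) ∧ key p.1 m ≠ key p.2 m) :
    R.card * l ≤ Nat.log 2 N *
      (2 * (Finset.univ.image fun z => win (key z) (3 * l)).card) := by
  classical
  let f : (Fin N × Fin N) × ℕ → Bool × List α := fun q =>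
    if cnt key l (prev^[q.2] q.1.1) (q.2 - 1) ≤ cnt key l (prev^[q.2] q.1.2) (q.2 - 1)
    then (false, win (key (prev^[q.2] q.1.1)) (3 * l))
    else (true, win (key (prev^[q.2] q.1.2)) (3 * l))
  have key' := key_iter key prev hprev
  -- the two light inequalities
  have hsum : ∀ p ∈ R, ∀ k ∈ Finset.Icc 1 l,
      cnt key l (prev^[k] p.1) (k-1) + cnt key l (prev^[k] p.2) (k-1)
        ≤ cnt key l (prev^[k] p.1) k ∧
      cnt key l (prev^[k] p.1) (k-1) + cnt key l (prev^[k] p.2) (k-1)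
        ≤ cnt key l (prev^[k] p.2) k := by
    intro p hp k hk
    rw [Finset.mem_Icc] at hk
    obtain ⟨h1, h2, m, h3, h4, h5, h6⟩ := hR p hp
    have hagree : ∀ t, k ≤ t → t < l → key (prev^[k] p.1) t = key (prev^[k] p.2) t := by
      intro t ht htl
      obtain ⟨u, rfl⟩ := Nat.exists_eq_add_of_le' ht
      rw [key', key']
      exact h5 u (by omega)
    have hne : key (prev^[k] p.1) (k-1) ≠ key (prev^[k] p.2) (k-1) := by
      obtain ⟨k, rfl⟩ := Nat.exists_eq_add_of_le' hk.1
      have e1 := key' k (prev p.1) 0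
      have e2 := key' k (prev p.2) 0
      rw [zero_add, ← Function.iterate_succ_apply] at e1 e2
      simp only [Nat.add_sub_cancel]
      rw [e1, e2]
      exact h2
    refine ⟨cnt_add key l _ _ k hk.1 hk.2 hagree hne, ?_⟩
    rw [add_comm]
    exact cnt_add key l _ _ k hk.1 hk.2 (fun t a b => (hagree t a b).symm) hne.symm
  have hmain := Finset.card_le_mul_card_image_of_maps_to (s := R ×ˢ Finset.Icc 1 l)
    (t := (Finset.univ : Finset Bool) ×ˢ (Finset.univ.image fun z => win (key z) (3 * l)))
    (f := f) (by
      intro q _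
      simp only [f]
      split_ifs <;> simp) (Nat.log 2 N) (by
      rintro ⟨side, S⟩ hS
      simp only [Finset.mem_product, Finset.mem_univ, true_and, Finset.mem_image] at hS
      obtain ⟨z, rfl⟩ := hS
      refine le_trans ?_ (light_card key l z)
      have hfib : ∀ q ∈ (R ×ˢ Finset.Icc 1 l).filter (fun q => f q = (side, win (key z) (3*l))),
          q.1 ∈ R ∧ q.2 ∈ Finset.Icc 1 l ∧
          2 * cnt key l z (q.2 - 1) ≤ cnt key l z q.2 ∧
          (∀ t < 2 * l, key (if side then q.1.2 else q.1.1) t = key z (t + q.2)) := by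
        rintro ⟨p, k⟩ hq
        simp only [Finset.mem_filter, Finset.mem_product] at hq
        obtain ⟨⟨hp, hk⟩, hf⟩ := hq
        refine ⟨hp, hk, ?_⟩
        obtain ⟨s1, s2⟩ := hsum p hp k hk
        rw [Finset.mem_Icc] at hk
        simp only [f] at hf
        split_ifs at hf with hc
        · simp only [Prod.mk.injEq, win_eq_iff] at hf
          obtain ⟨rfl, hw⟩ := hf
          have hc' := fun k' => cnt_congr key l _ z k' (fun t ht => hw t (by omega))
          simp only [hc'] at s1 hc
          refine ⟨by simp only; omega, ?_⟩
          intro t ht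
          simp only [Bool.false_eq_true, if_false]
          rw [← key' k p.1 t]
          exact hw _ (by omega)
        · simp only [Prod.mk.injEq, win_eq_iff] at hf
          obtain ⟨rfl, hw⟩ := hf
          have hc' := fun k' => cnt_congr key l _ z k' (fun t ht => hw t (by omega))
          simp only [hc'] at s2 hc
          refine ⟨by simp only; omega, ?_⟩
          intro t ht
          simp only [if_true]
          rw [← key' k p.2 t]
          exact hw _ (by omega)
      apply Finset.card_le_card_of_injOn (fun q => q.2)
      · intro q hq
        obtain ⟨h1, h2, h3, h4⟩ := hfib q hq
        simp only [Finset.coe_filter, Set.mem_ofPred_eq]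
        exact ⟨h2, h3⟩
      · intro q hq q' hq' hqq
        obtain ⟨h1, h2, h3, h4⟩ := hfib q hq
        obtain ⟨h1', h2', h3', h4'⟩ := hfib q' hq'
        obtain ⟨a1, -, m, -, a4, -, a6⟩ := hR _ h1
        obtain ⟨b1, -, m', -, b4, -, b6⟩ := hR _ h1'
        simp only at hqq
        refine Prod.ext (pair_determined key mono (2*l) _ _ a1 b1 ⟨m, a4, a6⟩ ⟨m', b4, b6⟩ ?_) hqq
        cases side
        · left
          intro t ht
          have e1 := h4 t ht
          have e2 := h4' t ht
          simp only [Bool.false_eq_true, if_false] at e1 e2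
          rw [e1, e2, hqq]
        · right
          intro t ht
          have e1 := h4 t ht
          have e2 := h4' t ht
          simp only [if_true] at e1 e2
          rw [e1, e2, hqq])
  simpa [Finset.card_product] using hmain

lemma total_bound (mono : ∀ r s, r ≤ s → lexLE (key r) (key s))
    (prev : Fin N → Fin N) (hprev : ∀ y t, key (prev y) (t+1) = key y t)
    (hper : ∀ y, ∃ p, 0 < p ∧ p ≤ N ∧ ∀ t, key y (t + p) = key y t)
    (K : ℕ) (hK : ∀ m, 1 ≤ m → (Finset.univ.image fun z => win (key z) m).card ≤ K * m)
    (R : Finset (Fin N × Fin N))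
    (hR : ∀ p ∈ R, p.1.val + 1 = p.2.val ∧ key (prev p.1) 0 ≠ key (prev p.2) 0) :
    R.card ≤ K + (Nat.log 2 N + 2) * (6 * K * Nat.log 2 N) := by
  classical
  have hmul : ∀ (u : ℕ → α) (p : ℕ), (∀ t, u (t + p) = u t) → ∀ j t, u (t + p * j) = u t := by
    intro u p hp j
    induction j with
    | zero => intro t; rfl
    | succ j ih => intro t; rw [Nat.mul_succ, ← add_assoc, hp, ih]
  have hdiff : ∀ p ∈ R, ∃ m < 2 * N, (∀ t < m, key p.1 t = key p.2 t) ∧ key p.1 m ≠ key p.2 m := by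
    intro p hp
    obtain ⟨h1, h2⟩ := hR p hp
    have hex : ∃ m < 2 * N, key p.1 m ≠ key p.2 m := by
      by_contra! hcon
      obtain ⟨a, ha, haN, hpa⟩ := hper p.1
      obtain ⟨b, hb, hbN, hpb⟩ := hper p.2
      have hall : ∀ t, key p.1 t = key p.2 t := by
        intro t
        induction t using Nat.strong_induction_on with
        | _ t ih =>
          by_cases ht : t < a + b
          · exact hcon t (by omega)
          · obtain ⟨u, rfl⟩ := Nat.exists_eq_add_of_le' (not_lt.1 ht)
            have e1 := ih (u + b) (by omega)
            have e2 := ih u (by omega)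
            have e3 := ih (u + a) (by omega)
            have f1 := hpa (u + b)
            have f2 := hpb (u + a)
            have f3 := hpa u
            have f4 := hpb u
            rw [show u + (a + b) = u + b + a by ring, f1, e1, f4, ← e2, ← f3, e3, ← f2]
            congr 1
            ring
      obtain ⟨c, hc, -, hpc⟩ := hper (prev p.1)
      obtain ⟨d, hd, -, hpd⟩ := hper (prev p.2)
      apply h2
      have g1 := hmul _ _ hpc d 0
      have g2 := hmul _ _ hpd c 0
      have : 0 < c * d := Nat.mul_pos hc hd
      obtain ⟨e, he⟩ := Nat.exists_eq_add_of_le' (Nat.succ_le_of_lt this)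
      rw [zero_add] at g1 g2
      rw [mul_comm d c] at g2
      rw [← g1, ← g2, he]
      exact (hprev _ _).trans ((hall _).trans (hprev _ _).symm)
    refine ⟨Nat.find hex, (Nat.find_spec hex).1, ?_, (Nat.find_spec hex).2⟩
    intro t ht
    have := Nat.find_min hex ht
    push Not at this
    exact this (ht.trans (Nat.find_spec hex).1)
  let R0 := R.filter fun p => key p.1 0 ≠ key p.2 0
  let RR : ℕ → Finset (Fin N × Fin N) := fun i => R.filter fun p =>
    ∃ m, 2 ^ i ≤ m ∧ m < 2 * 2 ^ i ∧ (∀ t < m, key p.1 t = key p.2 t) ∧ key p.1 m ≠ key p.2 m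
  have hcover : R ⊆ R0 ∪ (Finset.range (Nat.log 2 N + 2)).biUnion RR := by
    intro p hp
    obtain ⟨m, hm, h1, h2⟩ := hdiff p hp
    rw [Finset.mem_union, Finset.mem_biUnion]
    rcases Nat.eq_zero_or_pos m with h0 | h0
    · left; subst h0; exact Finset.mem_filter.2 ⟨hp, h2⟩
    · right
      refine ⟨Nat.log 2 m, ?_, Finset.mem_filter.2 ⟨hp, m, Nat.pow_log_le_self 2 h0.ne', ?_, h1, h2⟩⟩
      · rw [Finset.mem_range]
        have hN : N < 2 ^ (Nat.log 2 N + 1) := Nat.lt_pow_succ_log_self (by norm_num) N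
        apply Nat.log_lt_of_lt_pow h0.ne'
        rw [show Nat.log 2 N + 2 = (Nat.log 2 N + 1) + 1 by ring, pow_succ]
        omega
      · have := Nat.lt_pow_succ_log_self (b := 2) (by norm_num) m
        rw [pow_succ] at this
        omega
  have hR0 : R0.card ≤ K := by
    refine le_trans ?_ ((hK 1 le_rfl).trans (by simp))
    apply Finset.card_le_card_of_injOn (fun p => win (key p.1) 1)
    · intro p _
      simp
    · intro p hp q hq hpq
      have hp' := Finset.mem_filter.1 hp
      have hq' := Finset.mem_filter.1 hq
      simp only [win_eq_iff] at hpq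
      exact pair_determined key mono 1 p q (hR p hp'.1).1 (hR q hq'.1).1 ⟨0, by simp, hp'.2⟩
        ⟨0, by simp, hq'.2⟩ (Or.inl hpq)
  have hRR : ∀ i, (RR i).card ≤ 6 * K * Nat.log 2 N := by
    intro i
    have h := level_bound key mono prev hprev (2 ^ i) (RR i) (by
      intro p hp
      have hp' := Finset.mem_filter.1 hp
      exact ⟨(hR p hp'.1).1, (hR p hp'.1).2, hp'.2⟩)
    have hpos : 0 < 2 ^ i := by positivity
    have h2 := hK (3 * 2 ^ i) (by omega)
    refine Nat.le_of_mul_le_mul_right (h.trans ?_) hpos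
    calc _ ≤ Nat.log 2 N * (2 * (K * (3 * 2 ^ i))) := by gcongr
      _ = _ := by ring
  calc R.card ≤ (R0 ∪ (Finset.range (Nat.log 2 N + 2)).biUnion RR).card :=
        Finset.card_le_card hcover
    _ ≤ R0.card + ((Finset.range (Nat.log 2 N + 2)).biUnion RR).card := Finset.card_union_le _ _
    _ ≤ K + ∑ i ∈ Finset.range (Nat.log 2 N + 2), (RR i).card :=
        add_le_add hR0 Finset.card_biUnion_le
    _ ≤ K + ∑ i ∈ Finset.range (Nat.log 2 N + 2), 6 * K * Nat.log 2 N := by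
        gcongr with i _
        exact hRR i
    _ = _ := by simp

end Abstract

/-! ### Lexicographic order on lists -/

lemma lex_cons_le (a b : α) (u v : List α) : a :: u ≤ b :: v ↔ a < b ∨ a = b ∧ u ≤ v := by
  rw [le_iff_lt_or_eq, List.cons_lt_cons_iff, le_iff_lt_or_eq, List.cons.injEq]
  tauto

lemma lex_nil_le (u : List α) : [] ≤ u := by
  rw [← not_lt]; exact List.not_lt_nil _

lemma lex_append_left_le (f u v : List α) (h : u ≤ v) : f ++ u ≤ f ++ v := by
  induction f with
  | nil => exact h
  | cons a f ih => 
    rw [List.cons_append, List.cons_append, lex_cons_le]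
    exact Or.inr ⟨rfl, ih⟩

lemma lex_lt_append (u v x y : List α) (h : u < v) (hn : ¬ u <+: v) : u ++ x < v ++ y := by
  induction u generalizing v with
  | nil => exact absurd ⟨v, List.nil_append v⟩ hn
  | cons a u ih =>
    cases v with
    | nil => exact absurd h (List.not_lt_nil _)
    | cons b v =>
      rw [List.cons_lt_cons_iff] at h
      rw [List.cons_append, List.cons_append, List.cons_lt_cons_iff]
      rcases h with h | ⟨rfl, h⟩
      · exact Or.inl h
      · exact Or.inr ⟨rfl, ih v h (fun hp => hn (List.cons_prefix_cons.2 ⟨rfl, hp⟩))⟩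

lemma lex_take_le (u v : List α) (m : ℕ) (h : u ≤ v) : u.take m ≤ v.take m := by
  induction m generalizing u v with
  | zero => simp
  | succ m ih =>
    cases u with
    | nil => rw [List.take_nil]; exact lex_nil_le _
    | cons a u =>
      cases v with
      | nil => exact absurd h (not_le.2 (List.nil_lt_cons _ _))
      | cons b v =>
        rw [lex_cons_le] at h
        rw [List.take_succ_cons, List.take_succ_cons, lex_cons_le]
        exact h.imp_right fun h => ⟨h.1, ih _ _ h.2⟩

lemma lex_le_append (u v : List α) : u ≤ u ++ v := by
  simpa using lex_append_left_le u [] v (lex_nil_le v)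

lemma lyndon_lt_drop_append (f : List α) (hf : IsLyndon f) (s : ℕ) (h0 : 0 < s)
    (hs : s < f.length) (x y : List α) : f ++ x < f.drop s ++ y := by
  apply lex_lt_append _ _ _ _ (hf.2 s h0 hs)
  intro hp
  have := hp.length_le
  rw [List.length_drop] at this
  omega

lemma lyndon_comm_le (f g : List α) (hf : IsLyndon f) (hg : IsLyndon g) (h : g ≤ f) :
    g ++ f ≤ f ++ g := by
  rcases h.lt_or_eq with h | rfl
  · by_cases hp : g <+: f
    · obtain ⟨k, rfl⟩ := hp
      rw [List.append_assoc g k g]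
      apply lex_append_left_le
      rcases eq_or_ne k [] with rfl | hk
      · simp
      have := lyndon_lt_drop_append _ hf g.length (List.length_pos_of_ne_nil hg.1)
        (by simp [List.length_pos_of_ne_nil hk]) [] g
      simpa using this.le
    · exact (lex_lt_append _ _ _ _ h hp).le
  · exact le_rfl

lemma flatten_le_append (f : List α) (gs : List (List α)) (h : ∀ g ∈ gs, g ++ f ≤ f ++ g) :
    gs.flatten ++ f ≤ f ++ gs.flatten := by
  induction gs with
  | nil => simp
  | cons g gs ih =>
    have h1 := ih fun g' hg' => h g' (List.mem_cons_of_mem _ hg')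
    have h2 := h g List.mem_cons_self
    rw [List.flatten_cons, List.append_assoc]
    refine (lex_append_left_le g _ _ h1).trans ?_
    rw [← List.append_assoc, ← List.append_assoc]
    rcases h2.lt_or_eq with h2 | h2
    · refine (lex_lt_append _ _ _ _ h2 ?_).le
      intro hp
      have := hp.eq_of_length (by simp [add_comm])
      exact h2.ne this
    · rw [h2]

lemma suffix_min (A : List (List α)) (f : List α) (Bs : List (List α))
    (hL : ∀ g ∈ A ++ f :: Bs, IsLyndon g) (hP : (A ++ f :: Bs).Pairwise fun a b => b ≤ a)
    (s : ℕ) (hs : s < A.flatten.length + f.length) :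
    f ++ Bs.flatten ≤ (A ++ f :: Bs).flatten.drop s := by
  induction A generalizing s with
  | nil =>
    simp only [List.nil_append, List.flatten_cons, List.flatten_nil, List.length_nil, zero_add]
      at hs ⊢
    rcases Nat.eq_zero_or_pos s with rfl | h0
    · simp
    · rw [List.drop_append_of_le_length hs.le]
      exact (lyndon_lt_drop_append f (hL f (by simp)) s h0 hs _ _).le
  | cons a A ih =>
    rw [List.cons_append] at hL hP
    rw [List.pairwise_cons] at hP
    have ih' := ih (fun g hg => hL g (List.mem_cons_of_mem _ hg)) hP.2
    have ha := hL a List.mem_cons_self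
    rw [List.cons_append, List.flatten_cons]
    rw [List.flatten_cons, List.length_append] at hs
    by_cases hsa : s < a.length
    · have h1 : f ++ Bs.flatten ≤ (A ++ f :: Bs).flatten := by
        have hf : 0 < f.length :=
          List.length_pos_of_ne_nil (hL f (by simp)).1
        simpa using ih' 0 (by omega)
      have h2 : (A ++ f :: Bs).flatten ≤ a ++ (A ++ f :: Bs).flatten := 
        (lex_le_append _ a).trans (flatten_le_append a _ fun g hg =>
          lyndon_comm_le a g ha (hL g (List.mem_cons_of_mem _ hg)) (hP.1 g hg))
      refine h1.trans (h2.trans ?_)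
      rcases Nat.eq_zero_or_pos s with rfl | h0
      · simp
      · rw [List.drop_append_of_le_length hsa.le]
        exact (lyndon_lt_drop_append a ha s h0 hsa _ _).le
    · rw [List.drop_append, List.drop_eq_nil_of_le (not_lt.1 hsa), List.nil_append]
      exact ih' _ (by omega)

/-! ### LZ77 boundaries -/

/-- The set of phrase boundaries. -/
def bnds (zs : List (List α)) : Finset ℕ :=
  (Finset.range (zs.length + 1)).image fun k => (zs.take k).flatten.length

lemma bnds_card (zs : List (List α)) : (bnds zs).card ≤ zs.length + 1 :=
  Finset.card_image_le.trans (by simp)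

lemma mem_bnds_end (zs : List (List α)) : zs.flatten.length ∈ bnds zs := by
  refine Finset.mem_image.2 ⟨zs.length, by simp, by simp⟩

lemma getD_of_prefix_drop (d : α) (p w : List α) (s u : ℕ) (h : p <+: w.drop s)
    (hu : u < p.length) : w.getD (s + u) d = p.getD u d := by
  obtain ⟨t, ht⟩ := h
  rw [List.getD_eq_getElem?_getD, List.getD_eq_getElem?_getD, ← List.getElem?_drop, ← ht,
    List.getElem?_append_left hu]

lemma lz_leftmost (d : α) (w : List α) (zs : List (List α)) (hz : IsLZ77 w zs) (s m : ℕ)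
    (hm : 1 ≤ m) (hsm : s + m ≤ w.length)
    (hleft : ∀ s' < s, ¬ ∀ t < m, w.getD (s' + t) d = w.getD (s + t) d) :
    ∃ b ∈ bnds zs, s ≤ b ∧ b < s + m := by
  obtain ⟨hw, hne, hph⟩ := hz
  have hex : ∃ k, s < (zs.take k).flatten.length := ⟨zs.length, by rw [List.take_length, hw]; omega⟩
  obtain ⟨k, hk, hmin⟩ : ∃ k, s < (zs.take (k+1)).flatten.length ∧
      (zs.take k).flatten.length ≤ s := by
    have h1 := Nat.find_spec hex
    have h0 : Nat.find hex ≠ 0 := by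
      intro h0
      rw [h0] at h1
      simp at h1
    obtain ⟨k, hk⟩ := Nat.exists_eq_succ_of_ne_zero h0
    refine ⟨k, ?_, ?_⟩
    · rw [hk] at h1; exact h1
    · exact not_lt.1 (Nat.find_min hex (by omega))
  have hkl : k < zs.length := by
    by_contra hcon
    rw [List.take_of_length_le (by omega)] at hk hmin
    omega
  have hsucc : (zs.take (k+1)).flatten = (zs.take k).flatten ++ zs[k] := by
    rw [List.take_succ_eq_append_getElem hkl, List.flatten_append, List.flatten_singleton]
  have hmem : ∀ j ≤ zs.length, (zs.take j).flatten.length ∈ bnds zs := fun j hj =>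
    Finset.mem_image.2 ⟨j, by simp; omega, rfl⟩
  by_cases h1 : (zs.take k).flatten.length = s
  · exact ⟨_, hmem k hkl.le, by omega, by omega⟩
  by_cases h2 : (zs.take (k+1)).flatten.length < s + m
  · exact ⟨_, hmem (k+1) hkl, by omega, by omega⟩
  exfalso
  rw [hsucc, List.length_append] at hk h2
  rcases hph k hkl with ⟨h3, -⟩ | ⟨⟨s', hs', hp⟩, -⟩
  · omega
  · have hp2 : zs[k] <+: w.drop (zs.take k).flatten.length := by
      have : w = (zs.take k).flatten ++ (zs[k] ++ (zs.drop (k+1)).flatten) := by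
        rw [← List.append_assoc, ← hsucc, ← List.flatten_append, List.take_append_drop, hw]
      rw [this, List.drop_left]
      exact List.prefix_append _ _
    apply hleft (s' + (s - (zs.take k).flatten.length)) (by omega)
    intro t ht
    have e1 := getD_of_prefix_drop d _ w s' (s - (zs.take k).flatten.length + t) hp (by omega)
    have e2 := getD_of_prefix_drop d _ w _ (s - (zs.take k).flatten.length + t) hp2 (by omega)
    rw [add_assoc, e1, ← e2]
    congr 1
    omega

lemma lz_occ (d : α) (w : List α) (zs : List (List α)) (hz : IsLZ77 w zs) (s m : ℕ)
    (hm : 1 ≤ m) (hsm : s + m ≤ w.length) :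
    ∃ s', (∀ t < m, w.getD (s' + t) d = w.getD (s + t) d) ∧
      ∃ b ∈ bnds zs, s' ≤ b ∧ b < s' + m := by
  classical
  have hex : ∃ s', s' ≤ s ∧ ∀ t < m, w.getD (s' + t) d = w.getD (s + t) d :=
    ⟨s, le_rfl, fun _ _ => rfl⟩
  have hsp := Nat.find_spec hex
  refine ⟨Nat.find hex, hsp.2, lz_leftmost d w zs hz _ m hm (by omega) ?_⟩
  intro s' hs' hcon
  exact Nat.find_min hex hs' ⟨by omega, fun t ht => (hcon t ht).trans (hsp.2 t ht)⟩

/-! ### Windows of the cyclic factors -/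

/-- The infinite periodic word of `f`. -/
def perw (d : α) (f : List α) (t : ℕ) : α := f.getD (t % f.length) d

lemma take_drop_eq (d : α) (w : List α) (a b m : ℕ) (h : (w.drop a).take m = (w.drop b).take m)
    (t : ℕ) (ht : t < m) : w.getD (a + t) d = w.getD (b + t) d := by
  have h1 : ((w.drop a).take m)[t]? = ((w.drop b).take m)[t]? := by rw [h]
  rw [List.getElem?_take_of_lt ht, List.getElem?_take_of_lt ht, List.getElem?_drop,
    List.getElem?_drop] at h1
  rw [List.getD_eq_getElem?_getD, List.getD_eq_getElem?_getD, h1]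

lemma eq_take_drop (d : α) (w : List α) (a b m : ℕ) (ha : a + m ≤ w.length) (hb : b + m ≤ w.length)
    (h : ∀ t < m, w.getD (a + t) d = w.getD (b + t) d) :
    (w.drop a).take m = (w.drop b).take m := by
  apply List.ext_getElem
  · simp; omega
  · intro t h1 h2
    simp only [List.length_take, List.length_drop] at h1 h2
    have := h t (by omega)
    rw [List.getD_eq_getElem _ _ (by omega), List.getD_eq_getElem _ _ (by omega)] at this
    simpa using this

lemma good_or_bad (d : α) (w : List α) (zs : List (List α)) (hz : IsLZ77 w zs)
    (A : List (List α)) (f : List α) (Bs : List (List α)) (hw : (A ++ f :: Bs).flatten = w)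
    (hL : ∀ g ∈ A ++ f :: Bs, IsLyndon g) (hP : (A ++ f :: Bs).Pairwise fun a b => b ≤ a)
    (m : ℕ) (hm : 1 ≤ m) :
    (A.flatten.length + f.length + m ≤ w.length ∧
      ∀ u < f.length + m, w.getD (A.flatten.length + u) d = perw d f u) ∨
    ∃ b ∈ bnds zs, A.flatten.length + f.length ≤ b ∧ b < A.flatten.length + f.length + m := by
  have hlen : w.length = A.flatten.length + (f.length + Bs.flatten.length) := by
    rw [← hw]; simp
  by_cases hE : w.length < A.flatten.length + f.length + m
  · right
    refine ⟨w.length, ?_, by omega, hE⟩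
    have := mem_bnds_end zs
    rwa [hz.1] at this
  rw [not_lt] at hE
  have hfpos : 0 < f.length := List.length_pos_of_ne_nil (hL f (by simp)).1
  by_cases hocc : ∃ s' < A.flatten.length + f.length,
      ∀ t < m, w.getD (s' + t) d = w.getD (A.flatten.length + f.length + t) d
  · left
    refine ⟨hE, ?_⟩
    obtain ⟨s', hs', hagree⟩ := hocc
    have hX : w.drop A.flatten.length = f ++ Bs.flatten := by
      rw [← hw]; simp
    have hEd : w.drop (A.flatten.length + f.length) = Bs.flatten := by
      rw [← List.drop_drop, hX, List.drop_left]
    have h1 : f ++ Bs.flatten ≤ w.drop s' := by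
      rw [← hw]; exact suffix_min A f Bs hL hP s' hs'
    have h2 : Bs.flatten ≤ f ++ Bs.flatten := by
      have hP2 := (List.pairwise_append.1 hP).2.1
      rw [List.pairwise_cons] at hP2
      exact (lex_le_append _ f).trans (flatten_le_append f _ fun g hg =>
        lyndon_comm_le f g (hL f (by simp)) (hL g (by simp [hg])) (hP2.1 g hg))
    have h3 := eq_take_drop d w _ _ m (by omega) (by omega) hagree
    rw [← hX] at h1 h2
    rw [← hEd] at h2
    have h4 : (w.drop A.flatten.length).take m = (w.drop (A.flatten.length + f.length)).take m :=
      le_antisymm ((lex_take_le _ _ m h1).trans h3.le) (lex_take_le _ _ m h2)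
    have h5 := take_drop_eq d w _ _ m h4
    intro u
    induction u using Nat.strong_induction_on with
    | _ u ih =>
      intro hu
      by_cases huf : u < f.length
      · rw [perw, Nat.mod_eq_of_lt huf]
        exact getD_of_prefix_drop d f w _ u (by rw [hX]; exact List.prefix_append _ _) huf
      · obtain ⟨v, rfl⟩ := Nat.exists_eq_add_of_le (not_lt.1 huf)
        have e1 := ih v (by omega) (by omega)
        have e2 := h5 v (by omega)
        rw [← add_assoc, ← e2, e1, perw, perw, Nat.add_mod_left]
  · right
    exact lz_leftmost d w zs hz _ m hm hE (fun s' hs' hcon => hocc ⟨s', hs', hcon⟩)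

/-- Global windows of the cyclic text, indexed by global positions. -/
lemma window_cover (d : α) (w : List α) (zs : List (List α)) (hz : IsLZ77 w zs)
    (A : List (List α)) (f : List α) (Bs : List (List α)) (hw : (A ++ f :: Bs).flatten = w)
    (hL : ∀ g ∈ A ++ f :: Bs, IsLyndon g) (hP : (A ++ f :: Bs).Pairwise fun a b => b ≤ a)
    (m : ℕ) (hm : 1 ≤ m) (j : ℕ) (hj : j < f.length) :
    (∃ b ∈ bnds zs, ∃ s, s ≤ b ∧ b < s + m ∧
      win (fun t => perw d f (j + t)) m = win (fun t => w.getD (s + t) d) m) ∨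
    ∃ b ∈ bnds zs, A.flatten.length + j ≤ b ∧ b < A.flatten.length + j + 2 * m := by
  have hlen : w.length = A.flatten.length + (f.length + Bs.flatten.length) := by
    rw [← hw]; simp
  have key : (A.flatten.length + j + m ≤ w.length ∧
      ∀ t < m, perw d f (j + t) = w.getD (A.flatten.length + j + t) d) ∨
      ∃ b ∈ bnds zs, A.flatten.length + j ≤ b ∧ b < A.flatten.length + j + 2 * m := by
    by_cases hin : j + m ≤ f.length
    · left
      refine ⟨by omega, fun t ht => ?_⟩
      have hX : w.drop A.flatten.length = f ++ Bs.flatten := by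
        rw [← hw]; simp
      rw [perw, Nat.mod_eq_of_lt (by omega), add_assoc]
      exact (getD_of_prefix_drop d f w _ _ (by rw [hX]; exact List.prefix_append _ _)
        (by omega)).symm
    · rcases good_or_bad d w zs hz A f Bs hw hL hP m hm with ⟨h1, h2⟩ | ⟨b, hb, h1, h2⟩
      · left
        refine ⟨by omega, fun t ht => ?_⟩
        rw [add_assoc]
        exact (h2 (j + t) (by omega)).symm
      · right
        exact ⟨b, hb, by omega, by omega⟩
  rcases key with ⟨h1, h2⟩ | h
  · left
    obtain ⟨s, hs, b, hb, hb1, hb2⟩ := lz_occ d w zs hz _ m hm h1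
    refine ⟨b, hb, s, hb1, hb2, ?_⟩
    rw [win_eq_iff]
    intro t ht
    exact (h2 t ht).trans (hs t ht).symm
  · exact Or.inr h

/-! ### The omega order -/

lemma list_le_iff_lexLE (d : α) (u v : List α) (h : u.length = v.length) :
    u ≤ v ↔ lexLE (fun t => u.getD t d) (fun t => v.getD t d) := by
  induction u generalizing v with
  | nil =>
    have : v = [] := List.eq_nil_of_length_eq_zero h.symm
    subst this
    simp [lexLE]
  | cons a u ih =>
    cases v with
    | nil => simp at h
    | cons b v =>
      rw [lex_cons_le, ih v (by simpa using h)]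
      constructor
      · rintro (hab | ⟨rfl, hl⟩) t ht
        · cases t with
          | zero => simpa using hab.le
          | succ t =>
            have := ht 0 (by omega)
            simp only [List.getD_cons_zero] at this
            exact absurd this hab.ne
        · cases t with
          | zero => simp
          | succ t =>
            have := hl t (fun s hs => by simpa using ht (s+1) (by omega))
            simpa using this
      · intro hl
        have h0 := hl 0 (by simp)
        simp only [List.getD_cons_zero] at h0
        rcases h0.lt_or_eq with h0 | h0
        · exact Or.inl h0
        · refine Or.inr ⟨h0, fun t ht => ?_⟩
          have := hl (t+1) (fun s hs => by
            cases s with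
            | zero => simpa using h0
            | succ s => simpa using ht s (by omega))
          simpa using this

lemma perw_add_length (d : α) (f : List α) (t : ℕ) : perw d f (t + f.length) = perw d f t := by
  simp [perw]

lemma append_getD_perw (d : α) (x y : List α) (hx : x ≠ []) (t : ℕ)
    (ht : t < x.length + y.length) (h : ∀ s < t, perw d x s = perw d y s) :
    (x ++ y).getD t d = perw d x t := by
  have hp := List.length_pos_of_ne_nil hx
  by_cases htx : t < x.length
  · rw [List.getD_append _ _ _ _ htx, perw, Nat.mod_eq_of_lt htx]
  · obtain ⟨u, rfl⟩ := Nat.exists_eq_add_of_le' (not_lt.1 htx)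
    rw [List.getD_append_right _ _ _ _ (by omega), perw_add_length, h u (by omega), perw,
      Nat.mod_eq_of_lt (by omega)]
    congr 1
    omega

lemma perw_agree (d : α) (x y : List α) (hx : x ≠ []) 
    (h : ∀ t < x.length + y.length, perw d x t = perw d y t) (t : ℕ) :
    perw d x t = perw d y t := by
  have hp := List.length_pos_of_ne_nil hx
  induction t using Nat.strong_induction_on with
  | _ t ih =>
    by_cases ht : t < x.length + y.length
    · exact h t ht
    · obtain ⟨u, rfl⟩ := Nat.exists_eq_add_of_le' (not_lt.1 ht)
      by_cases hy : y = []
      · subst hy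
        have e1 := ih u (by simp; omega)
        simp only [List.length_nil, add_zero]
        rw [perw_add_length, e1]
        simp [perw]
      have hq := List.length_pos_of_ne_nil hy
      have e1 := ih (u + y.length) (by omega)
      have e2 := ih u (by omega)
      have e3 := ih (u + x.length) (by omega)
      rw [perw_add_length] at e1 e3
      rw [show u + (x.length + y.length) = u + y.length + x.length by ring, perw_add_length,
        ih (u + y.length) (by omega), perw_add_length,
        show u + y.length + x.length = u + x.length + y.length by ring, perw_add_length, e3.symm, e2]

lemma omegaLE_iff (d : α) (x y : List α) (hx : x ≠ []) (hy : y ≠ []) :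
    omegaLE x y ↔ lexLE (perw d x) (perw d y) := by
  unfold omegaLE
  rw [list_le_iff_lexLE d _ _ (by simp [add_comm])]
  have H1 := append_getD_perw d x y hx
  have H2 : ∀ t < x.length + y.length, (∀ s < t, perw d x s = perw d y s) →
      (y ++ x).getD t d = perw d y t := fun t ht h =>
    append_getD_perw d y x hy t (by omega) fun s hs => (h s hs).symm
  constructor
  · intro hl t ht
    by_cases htl : t < x.length + y.length
    · have := hl t (fun s hs => by
        have hs' : ∀ r < s, perw d x r = perw d y r := fun r hr => ht r (hr.trans hs)
        simp only
        rw [H1 s (hs.trans htl) hs', H2 s (hs.trans htl) hs', ht s hs])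
      simp only at this
      rwa [H1 t htl ht, H2 t htl ht] at this
    · exact (perw_agree d x y hx (fun s hs => ht s (by omega)) t).le
  · intro hl t ht
    by_cases htl : t < x.length + y.length
    · have hag : ∀ s < t, perw d x s = perw d y s := by
        intro s
        induction s using Nat.strong_induction_on with
        | _ s ih =>
          intro hs
          have hs' : ∀ r < s, perw d x r = perw d y r := fun r hr => ih r hr (hr.trans hs)
          have := ht s hs
          simp only at this
          rwa [H1 s (hs.trans htl) hs', H2 s (hs.trans htl) hs'] at this
      simp only
      rw [H1 t htl hag, H2 t htl hag]
      exact hl t hag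
    · simp only
      rw [List.getD_eq_default _ _ (by simp; omega), List.getD_eq_default _ _ (by simp; omega)]

/-! ### Rotations -/

lemma mem_rots (fs : List (List α)) (x : List α) (hx : x ∈ fs.flatMap rotations) :
    ∃ f ∈ fs, ∃ j < f.length, x = f.drop j ++ f.take j := by
  simp only [List.mem_flatMap, rotations, List.mem_map, List.mem_range] at hx
  obtain ⟨f, hf, j, hj, rfl⟩ := hx
  exact ⟨f, hf, j, hj, rfl⟩

lemma perw_rot (d : α) (f : List α) (j : ℕ) (hj : j < f.length) (t : ℕ) :
    perw d (f.drop j ++ f.take j) t = perw d f (j + t) := by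
  have hlen : (f.drop j ++ f.take j).length = f.length := by simp; omega
  rw [perw, perw, hlen, Nat.add_mod]
  have hr : t % f.length < f.length := Nat.mod_lt _ (by omega)
  generalize t % f.length = r at hr
  rw [Nat.mod_eq_of_lt hj]
  by_cases h : r < f.length - j
  · rw [List.getD_append _ _ _ _ (by simpa using h), Nat.mod_eq_of_lt (by omega),
      List.getD_eq_getElem?_getD, List.getD_eq_getElem?_getD, List.getElem?_drop]
  · rw [List.getD_append_right _ _ _ _ (by simp; omega), Nat.mod_eq_sub_mod (by omega),
      Nat.mod_eq_of_lt (by omega), List.getD_eq_getElem?_getD, List.getD_eq_getElem?_getD,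
      List.length_drop, List.getElem?_take_of_lt (by omega)]
    congr 2
    omega

lemma exists_prev (d : α) (fs : List (List α)) (x : List α) (hx : x ∈ fs.flatMap rotations) :
    ∃ y ∈ fs.flatMap rotations, (∀ t, perw d y (t+1) = perw d x t) ∧
      x.getLast?.toList = [perw d y 0] := by
  obtain ⟨f, hf, j, hj, rfl⟩ := mem_rots fs x hx
  have hpos : 0 < f.length := by omega
  have hj' : (j + (f.length - 1)) % f.length < f.length := Nat.mod_lt _ hpos
  have hlen : (f.drop j ++ f.take j).length = f.length := by simp; omega
  have hne : f.drop j ++ f.take j ≠ [] := by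
    intro h; rw [h] at hlen; simp at hlen; omega
  refine ⟨f.drop ((j + (f.length - 1)) % f.length) ++ f.take ((j + (f.length - 1)) % f.length),
    ?_, ?_, ?_⟩
  · simp only [List.mem_flatMap, rotations, List.mem_map, List.mem_range]
    exact ⟨f, hf, _, hj', rfl⟩
  · intro t
    rw [perw_rot d f _ hj', perw_rot d f j hj]
    unfold perw
    congr 1
    rw [Nat.mod_add_mod, show j + (f.length - 1) + (t + 1) = j + t + f.length by omega,
      Nat.add_mod_right]
  · rw [List.getLast?_eq_some_getLast hne, perw_rot d f _ hj']
    have e : (f.drop j ++ f.take j).getLast hne = perw d (f.drop j ++ f.take j) (f.length - 1) := by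
      rw [List.getLast_eq_getElem, perw, Nat.mod_eq_of_lt (by omega),
        List.getD_eq_getElem _ _ (by omega)]
      congr 1
      omega
    rw [e, perw_rot d f j hj]
    simp [perw]

/-! ### Counting windows -/

/-- The window of the cyclic text at a global position. -/
def cyc (d : α) (m : ℕ) : List (List α) → ℕ → List α
  | [], _ => []
  | f :: fs, y => if y < f.length then win (fun t => perw d f (y + t)) m
      else cyc d m fs (y - f.length)

lemma cyc_eq (d : α) (m : ℕ) (A : List (List α)) (f : List α) (Bs : List (List α)) (j : ℕ)
    (hj : j < f.length) :
    cyc d m (A ++ f :: Bs) (A.flatten.length + j) = win (fun t => perw d f (j + t)) m := by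
  induction A with
  | nil => simp [cyc, hj]
  | cons a A ih =>
    rw [List.cons_append, cyc, if_neg (by simp; omega), ← ih]
    congr 1
    simp
    omega

lemma window_count {N : ℕ} (d : α) (w : List α) (fs zs : List (List α)) (hz : IsLZ77 w zs)
    (hw : fs.flatten = w) (hL : ∀ g ∈ fs, IsLyndon g) (hP : fs.Pairwise fun a b => b ≤ a)
    (m : ℕ) (hm : 1 ≤ m) (rot : Fin N → List α) (hrot : ∀ z, rot z ∈ fs.flatMap rotations) :
    (Finset.univ.image fun z => win (perw d (rot z)) m).card ≤ 3 * (zs.length + 1) * m := by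
  classical
  have hsub : (Finset.univ.image fun z => win (perw d (rot z)) m) ⊆
      ((bnds zs).biUnion fun b => (Finset.range m).image fun i =>
        win (fun t => w.getD (b - i + t) d) m) ∪
      ((bnds zs).biUnion fun b => (Finset.range (2 * m)).image fun i => cyc d m fs (b - i)) := by
    intro S hS
    simp only [Finset.mem_image, Finset.mem_univ, true_and] at hS
    obtain ⟨z, rfl⟩ := hS
    obtain ⟨f, hf, j, hj, hx⟩ := mem_rots fs _ (hrot z)
    have e : perw d (rot z) = fun t => perw d f (j + t) := by
      funext t
      rw [hx, perw_rot d f j hj]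
    rw [e]
    obtain ⟨A, Bs, rfl⟩ := List.append_of_mem hf
    simp only [Finset.mem_union, Finset.mem_biUnion, Finset.mem_image, Finset.mem_range]
    rcases window_cover d w zs hz A f Bs hw hL hP m hm j hj with
      ⟨b, hb, s, h1, h2, h3⟩ | ⟨b, hb, h1, h2⟩
    · left
      refine ⟨b, hb, b - s, by omega, ?_⟩
      rw [h3, show b - (b - s) = s by omega]
    · right
      refine ⟨b, hb, b - (A.flatten.length + j), by omega, ?_⟩
      rw [show b - (b - (A.flatten.length + j)) = A.flatten.length + j by omega, cyc_eq _ _ _ _ _ _ hj]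
  have hb := bnds_card zs
  refine (Finset.card_le_card hsub).trans ((Finset.card_union_le _ _).trans ?_)
  have h1 := Finset.card_biUnion_le_card_mul (bnds zs) (fun b => (Finset.range m).image fun i =>
        win (fun t => w.getD (b - i + t) d) m) m (fun b _ => Finset.card_image_le.trans (by simp))
  have h2 := Finset.card_biUnion_le_card_mul (bnds zs) (fun b => (Finset.range (2 * m)).image
    fun i => cyc d m fs (b - i)) (2 * m) (fun b _ => Finset.card_image_le.trans (by simp))
  calc _ ≤ (bnds zs).card * m + (bnds zs).card * (2 * m) := add_le_add h1 h2
    _ ≤ (zs.length + 1) * m + (zs.length + 1) * (2 * m) := by gcongr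
    _ = _ := by ring

/-! ### Runs -/

lemma runCount_le (s : List α) : runCount s ≤
    1 + ∑ i ∈ Finset.range (s.length - 1), if s[i]? ≠ s[i+1]? then 1 else 0 := by
  unfold runCount
  induction s with
  | nil => simp
  | cons a s ih =>
    cases s with
    | nil => simp
    | cons b s =>
      have hl : (a :: b :: s).length - 1 = ((b :: s).length - 1) + 1 := by simp
      rw [hl, Finset.sum_range_succ']
      simp only [List.getElem?_cons_succ, List.getElem?_cons_zero, ne_eq, Option.some.injEq,
        zero_add] at ih ⊢
      change (List.destutter' (fun x y : α => ¬ x = y) b s).length ≤ _ at ih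
      change (List.destutter' (fun x y : α => ¬ x = y) a (b :: s)).length ≤ _
      by_cases hab : a = b
      · subst hab
        rw [List.destutter'_cons_neg _ (by simp)]
        omega
      · rw [List.destutter'_cons_pos _ hab, if_pos hab, List.length_cons]
        omega

lemma runCount_le_pairs {N : ℕ} (s : List α) (g : Fin N → α) (hs : s = List.ofFn g) :
    runCount s ≤ 1 + (Finset.univ.filter fun p : Fin N × Fin N =>
      p.1.val + 1 = p.2.val ∧ g p.1 ≠ g p.2).card := by
  refine (runCount_le s).trans (Nat.add_le_add_left ?_ 1)
  rw [← Finset.card_filter]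
  subst hs
  simp only [List.length_ofFn]
  apply Finset.card_le_card_of_surjOn (fun p => p.1.val)
  intro i hi
  simp only [Finset.coe_filter, Finset.mem_range, Set.mem_ofPred_eq] at hi
  obtain ⟨h1, h2⟩ := hi
  refine ⟨(⟨i, by omega⟩, ⟨i+1, by omega⟩), ?_, rfl⟩
  simp only [Finset.coe_filter, Finset.mem_univ, true_and, Set.mem_ofPred_eq]
  intro hg
  apply h2
  rw [List.getElem?_ofFn, List.getElem?_ofFn, dif_pos (by omega), dif_pos (by omega), hg]

lemma flatMap_eq_ofFn {β : Type*} (L : List β) (F : β → List α) (g : Fin L.length → α)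
    (h : ∀ r, F L[r] = [g r]) : L.flatMap F = List.ofFn g := by
  induction L with
  | nil => simp
  | cons a L ih =>
    rw [List.flatMap_cons, List.ofFn_succ]
    have h0 := h ⟨0, by simp⟩
    have h1 := ih (fun r => g r.succ) (fun r => h r.succ)
    rw [h1]
    simp only [Fin.getElem_fin, List.getElem_cons_zero] at h0
    rw [h0]
    rfl

lemma length_flatMap_rotations (fs : List (List α)) :
    (fs.flatMap rotations).length = fs.flatten.length := by
  induction fs with
  | nil => simp
  | cons f fs ih => rw [List.flatMap_cons, List.length_append, ih]; simp [rotations]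

lemma main_bound (w : List α) (hn : 2 ≤ w.length) (fs zs : List (List α))
    (hf : IsLyndonFactorization w fs) (hz : IsLZ77 w zs) :
    runCount (BBWTof fs) ≤ 1 + (3 * (zs.length + 1) +
      (Nat.log 2 w.length + 2) * (6 * (3 * (zs.length + 1)) * Nat.log 2 w.length)) := by
  classical
  obtain ⟨hw, hL, hC⟩ := hf
  have hP : fs.Pairwise fun a b => b ≤ a := by
    have : IsTrans (List α) (fun a b => b ≤ a) := ⟨fun a b c h1 h2 => le_trans h2 h1⟩
    exact List.isChain_iff_pairwise.1 hC
  have d : α := w[0]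
  set L := List.insertionSort omegaLE (fs.flatMap rotations) with hLdef
  have hmem : ∀ x, x ∈ L ↔ x ∈ fs.flatMap rotations := fun x => List.mem_insertionSort _
  have hlen : L.length = w.length := by
    rw [hLdef, List.length_insertionSort, length_flatMap_rotations, hw]
  have hnn : ∀ x ∈ fs.flatMap rotations, 0 < x.length ∧ x.length ≤ w.length := by
    intro x hx
    obtain ⟨f, hf, j, hj, rfl⟩ := mem_rots fs x hx
    have h1 : (f.drop j ++ f.take j).length = f.length := by simp; omega
    rw [h1, ← hw]
    exact ⟨by omega, (List.sublist_flatten_of_mem hf).length_le⟩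
  have hne : ∀ x ∈ fs.flatMap rotations, x ≠ [] := fun x hx =>
    List.ne_nil_of_length_pos (hnn x hx).1
  let key : Fin L.length → ℕ → α := fun r => perw d L[r]
  have hLr : ∀ r : Fin L.length, L[r] ∈ fs.flatMap rotations := fun r =>
    (hmem _).1 (List.getElem_mem _)
  have mono : ∀ r s, r ≤ s → lexLE (key r) (key s) := by
    have : IsTrans (ℕ → α) lexLE := ⟨fun a b c => lexLE_trans⟩
    have : Std.Total (lexLE (α := α)) := ⟨lexLE_total⟩
    have hs : (L.map (perw d)).Pairwise lexLE := by
      rw [hLdef, List.map_insertionSort omegaLE lexLE (perw d) _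
        (fun a ha b hb => omegaLE_iff d a b (hne a ha) (hne b hb))]
      exact List.pairwise_insertionSort _ _
    rw [List.pairwise_map] at hs
    intro r s hrs
    rcases hrs.lt_or_eq with h | rfl
    · exact List.pairwise_iff_get.1 hs r s h
    · exact fun t _ => le_rfl
  have hprev : ∀ r : Fin L.length, ∃ r' : Fin L.length, (∀ t, key r' (t+1) = key r t) ∧
      L[r].getLast?.toList = [key r' 0] := by
    intro r
    obtain ⟨y, hy, h1, h2⟩ := exists_prev d fs _ (hLr r)
    obtain ⟨i, hi, rfl⟩ := List.getElem_of_mem ((hmem y).2 hy)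
    exact ⟨⟨i, hi⟩, h1, h2⟩
  choose prev hprev1 hprev2 using hprev
  have hB : BBWTof fs = List.ofFn fun r => key (prev r) 0 :=
    flatMap_eq_ofFn L _ _ hprev2
  refine (runCount_le_pairs _ _ hB).trans (Nat.add_le_add_left ?_ 1)
  rw [← hlen]
  apply total_bound key mono prev hprev1
  · intro y
    refine ⟨L[y].length, (hnn _ (hLr y)).1, (hnn _ (hLr y)).2.trans hlen.ge, fun t => ?_⟩
    exact perw_add_length _ _ _
  · intro m hm
    exact window_count d w fs zs hz hw hL hP m hm (fun r => L[r]) hLr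
  · intro p hp
    exact (Finset.mem_filter.1 hp).2

/-- There is a universal constant `C` such that for every string `w` of length
`n ≥ 2`, `r_B(w) ≤ C · z(w) · (log₂ n)²`, where `z(w)` is the number of
phrases of the LZ77 factorization of `w`. -/
theorem bbwt_runs_le_lz77 :
    ∃ C : ℕ, 0 < C ∧ ∀ (α : Type) [LinearOrder α] (w : List α), 2 ≤ w.length →
      ∀ fs zs, IsLyndonFactorization w fs → IsLZ77 w zs →
        runCount (BBWTof fs) ≤ C * zs.length * (Nat.log 2 w.length) ^ 2 := by
  refine ⟨200, by norm_num, ?_⟩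
  intro α _ w hn fs zs hf hz
  refine (main_bound w hn fs zs hf hz).trans ?_
  have hz1 : 1 ≤ zs.length := by
    rcases Nat.eq_zero_or_pos zs.length with h | h
    · have h1 := hz.1
      rw [List.eq_nil_of_length_eq_zero h] at h1
      rw [← h1] at hn
      simp at hn
    · exact h
  have hl1 : 1 ≤ Nat.log 2 w.length := Nat.log_pos (by norm_num) hn
  generalize Nat.log 2 w.length = l at hl1
  generalize zs.length = z at hz1
  obtain ⟨l, rfl⟩ := Nat.exists_eq_add_of_le' hl1
  obtain ⟨z, rfl⟩ := Nat.exists_eq_add_of_le' hz1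
  ring_nf
  nlinarith [Nat.zero_le (z * l), Nat.zero_le (z * l ^ 2), Nat.zero_le (l ^ 2)]
end
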